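/- arXiv:1407.3251 — 8 statements merged into one kernel-verified Lean document; each statement's English description precedes it below -/
import Mathlib

section
/- Let h : ℝ² → ℝ be a homogeneous polynomial of degree k ≥ 2 and let H be a connected component of {x ∈ ℝ² : h(x) = 1} such that for every p ∈ H the Hessian D²h_p is definite (positive or negative definite) on the one-dimensional space ker Dh_p (i.e., H is locally strictly convex). Then for every T ∈ (0, ∞] every smooth curve γ : [0, T) → H that is not contained in any compact subset of H has infinite centroaffine length ∫₀^T √(|(1/k)·D²h_{γ(t)}(γ'(t), γ'(t))|) dt = ∞; that is, H is complete with respect to the centroaffine metric. -/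
open Set MeasureTheory ENNReal

open Polynomial Filter Topology

namespace MvPolynomial

lemma IsHomogeneous.eval_const_mul {σ : Type*} {P : MvPolynomial σ ℝ} {k : ℕ}
    (hP : P.IsHomogeneous k) (c : ℝ) (x : σ → ℝ) :
    eval (fun i => c * x i) P = c ^ k * eval x P := by
  rw [eval_eq, eval_eq, Finset.mul_sum]
  refine Finset.sum_congr rfl fun d hd => ?_
  have hdeg : d.degree = k := by
    by_contra hne
    exact (mem_support_iff.1 hd) (hP.coeff_eq_zero hne)
  rw [Finsupp.degree_apply] at hdeg
  simp only [mul_pow, Finset.prod_mul_distrib, Finset.prod_pow_eq_pow_sum]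
  rw [hdeg]
  ring

lemma contDiff_eval_euclideanSpace {ι : Type*} [Fintype ι] (P : MvPolynomial ι ℝ)
    {n : WithTop ℕ∞} :
    ContDiff ℝ n (fun x : EuclideanSpace ℝ ι => eval (fun i => x i) P) := by
  simp only [eval_eq]
  fun_prop

/-- The restriction of a polynomial to an affine line. -/
lemma exists_polynomial_eval_line {σ : Type*} {P : MvPolynomial σ ℝ} {k : ℕ}
    (hP : P.IsHomogeneous k) (q e : σ → ℝ) :
    ∃ φ : ℝ[X], φ.natDegree ≤ k ∧ ∀ s, eval (fun i => q i + s * e i) P = φ.eval s := by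
  refine ⟨aeval (fun i => Polynomial.C (q i) + Polynomial.C (e i) * Polynomial.X) P, ?_, ?_⟩
  · rw [← mul_one k]
    refine aeval_natDegree_le P hP.totalDegree_le _ fun i => ?_
    rw [add_comm]
    exact natDegree_linear_le
  · intro s
    rw [aeval_def, ← Polynomial.coe_evalRingHom, hom_eval₂, eval, coe_eval₂Hom]
    congr 1
    · ext r
      simp only [RingHom.id_apply, RingHom.comp_apply, Polynomial.algebraMap_apply,
        Algebra.algebraMap_self_apply, Polynomial.coe_evalRingHom, Polynomial.eval_C]
    · ext i
      simp only [Polynomial.coe_evalRingHom, Polynomial.eval_add, Polynomial.eval_mul,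
        Polynomial.eval_C, Polynomial.eval_X, mul_comm]

end MvPolynomial

section Euler

variable {E : Type*} [NormedAddCommGroup E] [NormedSpace ℝ E] {h : E → ℝ} {k : ℕ}

lemma fderiv_self_of_homogeneous (hd : Differentiable ℝ h)
    (hom : ∀ (c : ℝ) x, h (c • x) = c ^ k * h x) (p : E) :
    fderiv ℝ h p p = k * h p := by
  have h1 : HasDerivAt (fun c : ℝ => h (c • p)) (fderiv ℝ h ((1 : ℝ) • p) ((1 : ℝ) • p)) 1 :=
    (hd _).hasFDerivAt.comp_hasDerivAt (1 : ℝ) ((hasDerivAt_id (1 : ℝ)).smul_const p)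
  have h2 : HasDerivAt (fun c : ℝ => h (c • p)) (k * h p) 1 := by
    simp only [hom]
    simpa using (hasDerivAt_pow k (1 : ℝ)).mul_const (h p)
  simpa using h1.unique h2

lemma fderiv_fderiv_self_of_homogeneous (hd : ContDiff ℝ 2 h)
    (hom : ∀ (c : ℝ) x, h (c • x) = c ^ k * h x) (p w : E) :
    fderiv ℝ (fderiv ℝ h) p w p = (k - 1) * fderiv ℝ h p w := by
  have hd1 : Differentiable ℝ h := hd.differentiable (by norm_num)
  have hd2 : Differentiable ℝ (fderiv ℝ h) :=
    (hd.fderiv_right (m := 1) (by norm_num)).differentiable (by norm_num)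
  have h1 : HasFDerivAt (fun x => fderiv ℝ h x x) _ p :=
    (hd2 p).hasFDerivAt.clm_apply (hasFDerivAt_id p)
  have h2 : HasFDerivAt (fun x => fderiv ℝ h x x) ((k : ℝ) • fderiv ℝ h p) p := by
    simp only [fderiv_self_of_homogeneous hd1 hom]
    exact (hd1 p).hasFDerivAt.const_smul (k : ℝ)
  have h3 := congrArg (fun L : E →L[ℝ] ℝ => L w) (h1.unique h2)
  simp at h3
  linarith

lemma fderiv_line {φ : ℝ[X]} (hd : ContDiff ℝ 2 h)
    (hom : ∀ (c : ℝ) x, h (c • x) = c ^ k * h x) {q e : E}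
    (hφ : ∀ s : ℝ, h (q + s • e) = φ.eval s) (l s : ℝ) :
    l * fderiv ℝ h (l • (q + s • e)) e = l ^ k * φ.derivative.eval s ∧
    l ^ 2 * fderiv ℝ (fderiv ℝ h) (l • (q + s • e)) e e =
      l ^ k * φ.derivative.derivative.eval s := by
  have hd1 : Differentiable ℝ h := hd.differentiable (by norm_num)
  have hd2 : Differentiable ℝ (fderiv ℝ h) :=
    (hd.fderiv_right (m := 1) (by norm_num)).differentiable (by norm_num)
  have hline (s : ℝ) : HasDerivAt (fun t : ℝ => l • (q + t • e)) (l • e) s := by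
    have := (((hasDerivAt_id s).smul_const e).const_add q).const_smul l
    rwa [one_smul] at this
  have key (s : ℝ) :
      l * fderiv ℝ h (l • (q + s • e)) e = l ^ k * φ.derivative.eval s := by
    have h1 := (hd1 (l • (q + s • e))).hasFDerivAt.comp_hasDerivAt s (hline s)
    have h2 : HasDerivAt (h ∘ fun t : ℝ => l • (q + t • e)) (l ^ k * φ.derivative.eval s) s := by
      have : (h ∘ fun t : ℝ => l • (q + t • e)) = fun t => l ^ k * φ.eval t := by
        ext t; rw [Function.comp_apply, hom, hφ]
      rw [this]
      exact (φ.hasDerivAt s).const_mul _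
    simpa using h1.unique h2
  refine ⟨key s, ?_⟩
  have h1 : HasDerivAt (fun t => l * fderiv ℝ h (l • (q + t • e)) e)
      (l * fderiv ℝ (fderiv ℝ h) (l • (q + s • e)) (l • e) e) s :=
    HasDerivAt.const_mul l <| (ContinuousLinearMap.apply ℝ ℝ e).hasFDerivAt.comp_hasDerivAt s <|
      (hd2 (l • (q + s • e))).hasFDerivAt.comp_hasDerivAt s (hline s)
  have h2 : HasDerivAt (fun t => l * fderiv ℝ h (l • (q + t • e)) e)
      (l ^ k * φ.derivative.derivative.eval s) s := by
    simp only [key]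
    exact (φ.derivative.hasDerivAt s).const_mul _
  rw [← h1.unique h2, map_smul, smul_apply, smul_eq_mul]
  ring

end Euler

section Univariate

lemma exists_eventually_sq_le_mul_abs {c g : ℝ → ℝ} {a : ℝ} (hc : ContinuousAt c a)
    (hg : ContinuousAt g a) (ha : g a ≠ 0) :
    ∃ C, 0 ≤ C ∧ ∀ᶠ s in 𝓝 a, c s ^ 2 ≤ C * |g s| := by
  have hlim : ContinuousAt (fun s => c s ^ 2 / |g s|) a :=
    (hc.pow 2).div hg.abs (abs_ne_zero.2 ha)
  refine ⟨c a ^ 2 / |g a| + 1, by positivity, ?_⟩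
  filter_upwards [hlim.eventually_lt continuousAt_const (lt_add_one _), hg.eventually_ne ha]
    with s hs hgs
  exact (div_le_iff₀ (abs_pos.2 hgs)).1 hs.le

/-- Near a zero of order `m < k` of `φ`, both sides of the inequality are of order `2m - 2`. -/
lemma exists_eventually_sq_le_of_natDegree_le {φ : ℝ[X]} {k : ℕ} (hdeg : φ.natDegree ≤ k)
    (hne : ∃ s, k * φ.eval s * φ.derivative.derivative.eval s
      - (k - 1) * φ.derivative.eval s ^ 2 ≠ 0)
    (h0 : φ.eval 0 = 0 ∨ k * φ.eval 0 * φ.derivative.derivative.eval 0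
      - (k - 1) * φ.derivative.eval 0 ^ 2 ≠ 0) :
    ∃ C, 0 ≤ C ∧ ∀ᶠ s in 𝓝 0, φ.eval s ≠ 0 →
      (k * s * φ.eval s - (1 + s ^ 2) * φ.derivative.eval s) ^ 2 ≤
        C * |k * φ.eval s * φ.derivative.derivative.eval s
          - (k - 1) * φ.derivative.eval s ^ 2| := by
  rcases h0 with h0 | h0
  swap
  · obtain ⟨C, hC, h⟩ := exists_eventually_sq_le_mul_abs
      (c := fun s => k * s * φ.eval s - (1 + s ^ 2) * φ.derivative.eval s)
      (g := fun s => k * φ.eval s * φ.derivative.derivative.eval s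
          - (k - 1) * φ.derivative.eval s ^ 2) (a := 0) (by fun_prop) (by fun_prop) h0
    exact ⟨C, hC, h.mono fun s hs _ => hs⟩
  have hφ : φ ≠ 0 := by
    rintro rfl
    simp at hne
  obtain ⟨ψ, hψ, hdvd⟩ := exists_eq_pow_rootMultiplicity_mul_and_not_dvd φ hφ 0
  generalize φ.rootMultiplicity 0 = m at hψ
  rw [C_0, sub_zero] at hψ hdvd
  have hψ0 : ψ.eval 0 ≠ 0 := by
    rwa [X_dvd_iff, coeff_zero_eq_eval_zero] at hdvd
  have hψne : ψ ≠ 0 := by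
    rintro rfl
    simp at hψ0
  have hm0 : m ≠ 0 := by
    rintro rfl
    exact hψ0 (by simpa [hψ] using h0)
  have hdegm : m + ψ.natDegree ≤ k := by
    rwa [hψ, natDegree_X_pow_mul _ hψne, add_comm] at hdeg
  have e0 (s : ℝ) : φ.eval s = s ^ m * ψ.eval s := by simp [hψ]
  obtain ⟨n, rfl⟩ : ∃ n, m = n + 1 := Nat.exists_eq_succ_of_ne_zero hm0
  have e1 (s : ℝ) : s * φ.derivative.eval s =
      s ^ (n + 1) * ((n + 1) * ψ.eval s + s * ψ.derivative.eval s) := by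
    simp [hψ, derivative_mul]
    ring
  have e2 (s : ℝ) : s ^ 2 * φ.derivative.derivative.eval s =
      s ^ (n + 1) * ((n + 1) * n * ψ.eval s + 2 * (n + 1) * s * ψ.derivative.eval s
        + s ^ 2 * ψ.derivative.derivative.eval s) := by
    rcases n with _ | n <;>
    · simp [hψ, derivative_mul]
      ring
  have hmk : n + 1 ≠ k := by
    rintro rfl
    have hψC : ψ = Polynomial.C (ψ.eval 0) := by
      rw [← coeff_zero_eq_eval_zero]
      exact eq_C_of_natDegree_eq_zero (by omega)
    obtain ⟨s, hs⟩ := hne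
    apply hs
    rw [hψ, hψC]
    rcases n with _ | n <;>
    · simp [derivative_mul]
      try ring
  obtain ⟨C, hC, h⟩ := exists_eventually_sq_le_mul_abs
    (c := fun s => k * s ^ 2 * ψ.eval s
      - (1 + s ^ 2) * ((n + 1) * ψ.eval s + s * ψ.derivative.eval s))
    (g := fun s => k * ψ.eval s * ((n + 1) * n * ψ.eval s + 2 * (n + 1) * s * ψ.derivative.eval s
        + s ^ 2 * ψ.derivative.derivative.eval s)
        - (k - 1) * ((n + 1) * ψ.eval s + s * ψ.derivative.eval s) ^ 2) (a := 0)
    (by fun_prop) (by fun_prop) (by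
      have : (n + 1 - k : ℝ) ≠ 0 := by
        rw [sub_ne_zero]
        exact_mod_cast hmk
      have h2 : (n + 1 : ℝ) * (n + 1 - k) * ψ.eval 0 ^ 2 ≠ 0 := by positivity
      convert h2 using 1
      ring)
  refine ⟨C, hC, h.mono fun s hs hφs => ?_⟩
  have hs0 : s ≠ 0 := by
    rintro rfl
    exact hφs h0
  have hs2 : 0 < s ^ 2 := by positivity
  refine le_of_mul_le_mul_left ?_ hs2
  calc _ = (s ^ (n + 1)) ^ 2 * (k * s ^ 2 * ψ.eval s
      - (1 + s ^ 2) * ((n + 1) * ψ.eval s + s * ψ.derivative.eval s)) ^ 2 := by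
        rw [← mul_pow, ← mul_pow]
        congr 1
        linear_combination k * s ^ 2 * e0 s - (1 + s ^ 2) * e1 s
    _ ≤ (s ^ (n + 1)) ^ 2 * _ := mul_le_mul_of_nonneg_left hs (by positivity)
    _ = _ := by
        rw [mul_left_comm, mul_left_comm (s ^ 2)]
        congr 1
        have habs (x y : ℝ) : x ^ 2 * |y| = |x ^ 2 * y| := by
          rw [abs_mul, abs_of_nonneg (sq_nonneg x)]
        rw [habs, habs]
        congr 1
        linear_combination (-k * s ^ 2 * φ.derivative.derivative.eval s) * e0 s
          + (k - 1) * (s * φ.derivative.eval s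
            + s ^ (n + 1) * ((n + 1) * ψ.eval s + s * ψ.derivative.eval s)) * e1 s
          - k * s ^ (n + 1) * ψ.eval s * e2 s

end Univariate

section Chart

variable {E : Type*} [NormedAddCommGroup E] [InnerProductSpace ℝ E] {h : E → ℝ} {k : ℕ}

/-- The second derivative of `h` and the radial component of a tangent vector `v` of `{h = 1}`
at `p = l (q + s e)`, expressed through the restriction of `h` to the line `q + ℝ e`. -/
lemma tangent_in_chart {φ : ℝ[X]} (hd : ContDiff ℝ 2 h)
    (hom : ∀ (c : ℝ) x, h (c • x) = c ^ k * h x) {q e : E}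
    (hq : ‖q‖ = 1) (he : ‖e‖ = 1) (hqe : inner ℝ q e = 0)
    (hφ : ∀ s : ℝ, h (q + s • e) = φ.eval s) {l s a b : ℝ} {p v : E}
    (hp : p = l • (q + s • e)) (hp1 : h p = 1) (hv : v = a • p + b • e)
    (hker : fderiv ℝ h p v = 0) :
    l ^ 2 * (k * fderiv ℝ (fderiv ℝ h) p v v) =
      b ^ 2 * (l ^ k) ^ 2 * (k * φ.eval s * φ.derivative.derivative.eval s
        - (k - 1) * φ.derivative.eval s ^ 2) ∧
    k * inner ℝ p v =
      b * l * l ^ k * (k * s * φ.eval s - (1 + s ^ 2) * φ.derivative.eval s) := by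
  obtain ⟨h1, h2⟩ := fderiv_line hd hom hφ l s
  rw [← hp] at h1 h2
  have h3 := fderiv_self_of_homogeneous (hd.differentiable (by norm_num)) hom p
  have h4 := fderiv_fderiv_self_of_homogeneous hd hom p
  have hlφ : l ^ k * φ.eval s = 1 := by rw [← hφ, ← hom, ← hp, hp1]
  have hsymm : fderiv ℝ (fderiv ℝ h) p p e = fderiv ℝ (fderiv ℝ h) p e p :=
    hd.contDiffAt.isSymmSndFDerivAt (by simp) p e
  rw [hp1, mul_one] at h3
  have hker' : a * k + b * fderiv ℝ h p e = 0 := by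
    rw [hv, map_add, map_smul, map_smul, h3] at hker
    simpa using hker
  have hvv : fderiv ℝ (fderiv ℝ h) p v v = a ^ 2 * ((k - 1) * k)
      + 2 * a * b * ((k - 1) * fderiv ℝ h p e) + b ^ 2 * fderiv ℝ (fderiv ℝ h) p e e := by
    rw [hv]
    simp only [map_add, map_smul, add_apply, smul_apply, smul_eq_mul, hsymm, h4, h3]
    ring
  have hpv : inner ℝ p v = a * (l ^ 2 * (1 + s ^ 2)) + b * (l * s) := by
    have hqq : inner ℝ q q = (1 : ℝ) := by rw [real_inner_self_eq_norm_sq, hq]; norm_num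
    have hee : inner ℝ e e = (1 : ℝ) := by rw [real_inner_self_eq_norm_sq, he]; norm_num
    have heq : inner ℝ e q = (0 : ℝ) := by rw [real_inner_comm, hqe]
    rw [hv, hp]
    simp only [inner_add_left, inner_add_right, real_inner_smul_left, real_inner_smul_right,
      hqq, hee, heq, hqe]
    ring
  generalize fderiv ℝ h p e = D₁ at *
  generalize fderiv ℝ (fderiv ℝ h) p e e = D₂ at *
  generalize φ.derivative.derivative.eval s = f₂ at *
  generalize φ.derivative.eval s = f₁ at *
  generalize φ.eval s = f at *
  generalize l ^ k = L at *
  rw [hvv, hpv]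
  constructor
  · linear_combination l ^ 2 * (k - 1) * (a * k + b * D₁) * hker' + k * b ^ 2 * h2
      - (k - 1) * b ^ 2 * (l * D₁ + L * f₁) * h1 - k * b ^ 2 * L * f₂ * hlφ
  · linear_combination l ^ 2 * (1 + s ^ 2) * hker' - b * l * (1 + s ^ 2) * h1 - k * b * l * s * hlφ

/-- Nondegeneracy of the second derivative on the tangent line, in the chart of
`tangent_in_chart`. -/
lemma chart_ne_zero {φ : ℝ[X]} (hk : k ≠ 0) (hd : ContDiff ℝ 2 h)
    (hom : ∀ (c : ℝ) x, h (c • x) = c ^ k * h x) {q e : E}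
    (hq : ‖q‖ = 1) (he : ‖e‖ = 1) (hqe : inner ℝ q e = 0)
    (hφ : ∀ s : ℝ, h (q + s • e) = φ.eval s) {l s : ℝ} (hl : l ≠ 0) {p : E}
    (hp : p = l • (q + s • e)) (hp1 : h p = 1)
    (hnd : ∀ v, fderiv ℝ h p v = 0 → v ≠ 0 → fderiv ℝ (fderiv ℝ h) p v v ≠ 0) :
    k * φ.eval s * φ.derivative.derivative.eval s - (k - 1) * φ.derivative.eval s ^ 2 ≠ 0 := by
  intro h0
  have hkr : (k : ℝ) ≠ 0 := by exact_mod_cast hk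
  have h3 := fderiv_self_of_homogeneous (hd.differentiable (by norm_num)) hom p
  rw [hp1, mul_one] at h3
  set v := (-(fderiv ℝ h p e / k)) • p + (1 : ℝ) • e with hv
  have hker : fderiv ℝ h p v = 0 := by
    rw [hv, map_add, map_smul, map_smul, h3, smul_eq_mul, smul_eq_mul]
    field_simp
    ring
  have hv0 : v ≠ 0 := by
    intro hv0
    have h1 : inner ℝ q v = 0 := by rw [hv0, inner_zero_right]
    rw [hv, hp] at h1
    simp only [inner_add_right, real_inner_smul_right, hqe, real_inner_self_eq_norm_sq, hq] at h1
    rw [← hp] at h1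
    have h2 : fderiv ℝ h p e / k = 0 := by
      simpa [hl] using h1
    rw [hv, h2, neg_zero, zero_smul, zero_add, one_smul] at hv0
    simp [hv0] at he
  have key := (tangent_in_chart hd hom hq he hqe hφ hp hp1 hv hker).1
  rw [h0, mul_zero] at key
  exact hnd v hker hv0 (by simpa [hl, hkr] using key)

end Chart

section Plane

local notation "ℝ²" => EuclideanSpace ℝ (Fin 2)

lemma exists_orthonormal_completion {q : ℝ²} (hq : ‖q‖ = 1) :
    ∃ e : ℝ², ‖e‖ = 1 ∧ inner ℝ q e = 0 ∧ ∀ w : ℝ², w = inner ℝ q w • q + inner ℝ e w • e := by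
  have hq2 : q 0 ^ 2 + q 1 ^ 2 = 1 := by
    have := EuclideanSpace.real_norm_sq_eq q
    rw [hq, Fin.sum_univ_two] at this
    linarith
  refine ⟨!₂[-q 1, q 0], ?_, ?_, fun w => ?_⟩
  · rw [EuclideanSpace.norm_eq, Real.sqrt_eq_one, Fin.sum_univ_two]
    simp
    linarith
  · simp [PiLp.inner_apply, Fin.sum_univ_two]
    ring
  · ext i
    fin_cases i
    · simp [PiLp.inner_apply, Fin.sum_univ_two]
      linear_combination (- w 0) * hq2
    · simp [PiLp.inner_apply, Fin.sum_univ_two]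
      linear_combination (- w 1) * hq2

variable {h : ℝ² → ℝ} {k : ℕ} {H : Set ℝ²}

/-- A closed subset of `{h = 1}` contains the point of `{h = 1}` on every ray `ℝ₊ q` with `h q > 0`
which is a limit of rays meeting the subset. -/
lemma rescale_mem_of_mem_closure (hk : k ≠ 0) (hc : Continuous h)
    (hom : ∀ (c : ℝ) x, h (c • x) = c ^ k * h x) (hHc : IsClosed H) (hH : ∀ p ∈ H, h p = 1)
    {q : ℝ²} (hq : q ∈ closure ((fun p => ‖p‖⁻¹ • p) '' H)) (hpos : h q ≠ 0) :
    0 < h q ∧ (h q ^ (-(k : ℝ)⁻¹)) • q ∈ H := by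
  have hHp (p : ℝ²) (hp : p ∈ H) : 0 < ‖p‖ := by
    refine norm_pos_iff.2 ?_
    rintro rfl
    have := hom 0 0
    rw [zero_smul, zero_pow hk, hH 0 hp] at this
    simp at this
  have hcl : closure ((fun p => ‖p‖⁻¹ • p) '' H) ⊆ {x | 0 ≤ h x} := by
    refine closure_minimal ?_ (isClosed_le continuous_const hc)
    rintro _ ⟨p, hp, rfl⟩
    simp only [mem_ofPred_eq, hom, hH p hp]
    positivity
  refine ⟨lt_of_le_of_ne (hcl hq) hpos.symm, ?_⟩
  have hcont : ContinuousAt (fun x : ℝ² => (h x ^ (-(k : ℝ)⁻¹)) • x) q :=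
    (hc.continuousAt.rpow_const (Or.inl hpos)).smul continuousAt_id
  have hmem := _root_.mem_closure_image hcont hq
  refine hHc.closure_subset_iff.2 ?_ hmem
  rintro _ ⟨_, ⟨p, hp, rfl⟩, rfl⟩
  have hp0 := hHp p hp
  have hkr : (k : ℝ) ≠ 0 := by exact_mod_cast hk
  have : ((‖p‖⁻¹ ^ k * 1) ^ (-(k : ℝ)⁻¹)) = ‖p‖ := by
    rw [mul_one, ← Real.rpow_natCast, ← Real.rpow_mul (by positivity), mul_neg,
      mul_inv_cancel₀ hkr, Real.rpow_neg_one, inv_inv]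
  simp only [hom, hH p hp, this, smul_smul, mul_inv_cancel₀ hp0.ne', one_smul]
  exact hp

lemma exists_nhds_sq_inner_le (hk : k ≠ 0) (hd : ContDiff ℝ 2 h)
    (hom : ∀ (c : ℝ) x, h (c • x) = c ^ k * h x)
    (hline : ∀ q e : ℝ², ∃ φ : ℝ[X], φ.natDegree ≤ k ∧ ∀ s : ℝ, h (q + s • e) = φ.eval s)
    (hHc : IsClosed H) (hH : ∀ p ∈ H, h p = 1)
    (hnd : ∀ p ∈ H, ∀ v, fderiv ℝ h p v = 0 → v ≠ 0 → fderiv ℝ (fderiv ℝ h) p v v ≠ 0)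
    {q : ℝ²} (hq : q ∈ closure ((fun p => ‖p‖⁻¹ • p) '' H)) (hq1 : ‖q‖ = 1) :
    ∃ U ∈ 𝓝 q, ∃ C, 0 ≤ C ∧ ∀ p ∈ H, ‖p‖⁻¹ • p ∈ U → ∀ v, fderiv ℝ h p v = 0 →
      inner ℝ p v ^ 2 ≤ C * ‖p‖ ^ 4 * |fderiv ℝ (fderiv ℝ h) p v v| := by
  obtain ⟨e, he, hqe, hdec⟩ := exists_orthonormal_completion hq1
  obtain ⟨φ, hdeg, hφ⟩ := hline q e
  have hkr : (0 : ℝ) < k := by exact_mod_cast Nat.pos_of_ne_zero hk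
  have hchart {p : ℝ²} (hp : 0 < inner ℝ q p) :
      p = (inner ℝ q p : ℝ) • (q + ((inner ℝ e p / inner ℝ q p : ℝ)) • e) := by
    conv_lhs => rw [hdec p]
    rw [smul_add, smul_smul, mul_div_cancel₀ _ hp.ne']
  have hφ0 : φ.eval 0 = h q := by simp [← hφ]
  have hqq : (0 : ℝ) < inner ℝ q q := by rw [real_inner_self_eq_norm_sq, hq1]; norm_num
  have hposU : ∀ᶠ x in 𝓝 q, 0 < (inner ℝ q x : ℝ) :=
    continuousAt_const.eventually_lt (by fun_prop) hqq
  have hne : ∃ s, k * φ.eval s * φ.derivative.derivative.eval s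
      - (k - 1) * φ.derivative.eval s ^ 2 ≠ 0 := by
    obtain ⟨_, hx, p, hp, rfl⟩ := mem_closure_iff_nhds.1 hq _ hposU
    have hp0 : 0 < (inner ℝ q p : ℝ) := by
      simp only [mem_ofPred_eq, real_inner_smul_right] at hx
      exact pos_of_mul_pos_right hx (by positivity)
    exact ⟨_, chart_ne_zero hk hd hom hq1 he hqe hφ hp0.ne' (hchart hp0) (hH p hp) (hnd p hp)⟩
  have h0 : φ.eval 0 = 0 ∨ k * φ.eval 0 * φ.derivative.derivative.eval 0
      - (k - 1) * φ.derivative.eval 0 ^ 2 ≠ 0 := by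
    rw [or_iff_not_imp_left]
    intro hne
    obtain ⟨hpos, hmem⟩ := rescale_mem_of_mem_closure hk hd.continuous hom hHc hH hq (hφ0 ▸ hne)
    exact chart_ne_zero hk hd hom hq1 he hqe hφ (s := 0) (Real.rpow_pos_of_pos hpos _).ne'
      (by rw [zero_smul, add_zero])
      (hH _ hmem) (hnd _ hmem)
  obtain ⟨C, hC, hbound⟩ := exists_eventually_sq_le_of_natDegree_le hdeg hne h0
  have hslope : Tendsto (fun x : ℝ² => (inner ℝ e x / inner ℝ q x : ℝ)) (𝓝 q) (𝓝 0) := by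
    have : ContinuousAt (fun x : ℝ² => (inner ℝ e x / inner ℝ q x : ℝ)) q :=
      ContinuousAt.div (by fun_prop) (by fun_prop) hqq.ne'
    simpa [ContinuousAt, real_inner_comm, hqe] using this
  refine ⟨_, hposU.and (hslope.eventually hbound), C / k, by positivity, ?_⟩
  rintro p hp ⟨hpos, hb⟩ v hker
  have hnp : 0 < ‖p‖⁻¹ := by
    refine lt_of_le_of_ne (by positivity) fun h => ?_
    simp [← h] at hpos
  simp only [real_inner_smul_right, mul_div_mul_left _ _ hnp.ne'] at hb hpos
  have hl : 0 < (inner ℝ q p : ℝ) := pos_of_mul_pos_right hpos hnp.le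
  have hpe := hchart hl
  have hvdec : v = (inner ℝ q v / inner ℝ q p : ℝ) • p
      + (inner ℝ e v - inner ℝ q v / inner ℝ q p * inner ℝ e p : ℝ) • e := by
    have hap : (inner ℝ q v / inner ℝ q p : ℝ) • p
        = (inner ℝ q v : ℝ) • q + (inner ℝ q v / inner ℝ q p * inner ℝ e p : ℝ) • e := by
      have := congrArg (fun w => (inner ℝ q v / inner ℝ q p : ℝ) • w) (hdec p)
      simpa only [smul_add, smul_smul, div_mul_cancel₀ _ hl.ne'] using this
    rw [hap, sub_smul, add_assoc, add_sub_cancel]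
    exact hdec v
  have hlp : (inner ℝ q p : ℝ) ≤ ‖p‖ := by
    simpa [hq1] using real_inner_le_norm q p
  generalize (inner ℝ q v / inner ℝ q p : ℝ) = a at hvdec
  generalize (inner ℝ e v - a * inner ℝ e p : ℝ) = b at hvdec
  generalize (inner ℝ e p / inner ℝ q p : ℝ) = s at *
  generalize (inner ℝ q p : ℝ) = l at *
  obtain ⟨h1, h2⟩ := tangent_in_chart hd hom hq1 he hqe hφ hpe (hH p hp) hvdec hker
  have hφs : φ.eval s ≠ 0 := by
    intro h
    have := hH p hp
    rw [hpe, hom, hφ, h, mul_zero] at this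
    exact zero_ne_one this
  have hb := hb hφs
  generalize fderiv ℝ (fderiv ℝ h) p v v = B at *
  generalize (k * φ.eval s * φ.derivative.derivative.eval s
        - (k - 1) * φ.derivative.eval s ^ 2 : ℝ) = G at *
  generalize (k * s * φ.eval s - (1 + s ^ 2) * φ.derivative.eval s : ℝ) = A at *
  generalize (inner ℝ p v : ℝ) = I at *
  have hG : l ^ 2 * (k * |B|) = (b * l ^ k) ^ 2 * |G| := by
    have := congrArg abs h1
    rw [abs_mul, abs_mul, abs_mul, ← mul_pow, abs_of_nonneg (sq_nonneg l), abs_of_pos hkr,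
      abs_of_nonneg (sq_nonneg (b * l ^ k))] at this
    exact this
  have : (k * I) ^ 2 ≤ (k : ℝ) ^ 2 * (C / k * ‖p‖ ^ 4 * |B|) := by
    calc (k * I) ^ 2 = l ^ 2 * (b * l ^ k) ^ 2 * A ^ 2 := by rw [h2]; ring
      _ ≤ l ^ 2 * (b * l ^ k) ^ 2 * (C * |G|) := by gcongr
      _ = C * k * |B| * l ^ 4 := by linear_combination (-C * l ^ 2) * hG
      _ ≤ C * k * |B| * ‖p‖ ^ 4 := by gcongr
      _ = _ := by field_simp
  rw [mul_pow] at this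
  exact le_of_mul_le_mul_left this (by positivity)

theorem exists_sq_inner_le (hk : k ≠ 0) (hd : ContDiff ℝ 2 h)
    (hom : ∀ (c : ℝ) x, h (c • x) = c ^ k * h x)
    (hline : ∀ q e : ℝ², ∃ φ : ℝ[X], φ.natDegree ≤ k ∧ ∀ s : ℝ, h (q + s • e) = φ.eval s)
    (hHc : IsClosed H) (hH : ∀ p ∈ H, h p = 1)
    (hnd : ∀ p ∈ H, ∀ v, fderiv ℝ h p v = 0 → v ≠ 0 → fderiv ℝ (fderiv ℝ h) p v v ≠ 0) :
    ∃ C, 0 ≤ C ∧ ∀ p ∈ H, ∀ v, fderiv ℝ h p v = 0 →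
      inner ℝ p v ^ 2 ≤ C * ‖p‖ ^ 4 * |fderiv ℝ (fderiv ℝ h) p v v| := by
  set S := closure ((fun p => ‖p‖⁻¹ • p) '' H)
  have hS : S ⊆ Metric.sphere 0 1 := by
    refine closure_minimal ?_ Metric.isClosed_sphere
    rintro _ ⟨p, hp, rfl⟩
    have hp0 : p ≠ 0 := by
      rintro rfl
      have := hom 0 0
      rw [zero_smul, zero_pow hk, hH 0 hp] at this
      simp at this
    simp [norm_smul, hp0]
  have hScomp : IsCompact S := (isCompact_sphere 0 1).of_isClosed_subset isClosed_closure hS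
  have key := hScomp.induction_on (p := fun U => ∃ C, 0 ≤ C ∧ ∀ p ∈ H, ‖p‖⁻¹ • p ∈ U → ∀ v,
      fderiv ℝ h p v = 0 → inner ℝ p v ^ 2 ≤ C * ‖p‖ ^ 4 * |fderiv ℝ (fderiv ℝ h) p v v|)
    ⟨0, le_rfl, by simp⟩
    (fun U V hUV ⟨C, hC, hV⟩ => ⟨C, hC, fun p hp hpU => hV p hp (hUV hpU)⟩)
    (by
      rintro U V ⟨C, hC, hU⟩ ⟨D, hD, hV⟩
      refine ⟨max C D, le_max_of_le_left hC, ?_⟩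
      rintro p hp (hpU | hpV) v hv
      · refine (hU p hp hpU v hv).trans ?_
        gcongr
        exact le_max_left _ _
      · refine (hV p hp hpV v hv).trans ?_
        gcongr
        exact le_max_right _ _)
    (fun q hq => by
      obtain ⟨U, hU, hC⟩ := exists_nhds_sq_inner_le hk hd hom hline hHc hH hnd hq
        (by simpa using hS hq)
      exact ⟨U, mem_nhdsWithin_of_mem_nhds hU, hC⟩)
  obtain ⟨C, hC, hbound⟩ := key
  exact ⟨C, hC, fun p hp => hbound p hp (subset_closure (mem_image_of_mem _ hp))⟩

end Plane

section Length

lemma sub_le_mul_lintegral_of_hasDerivAt_le {f g : ℝ → ℝ} {I : Set ℝ} (hI : I.OrdConnected)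
    (hf : ContinuousOn f I) (hf0 : ∀ t, 0 ≤ f t) (hg : ContinuousOn g I) {M : ℝ} (hM : 0 ≤ M)
    (hderiv : ∀ t ∈ interior I, ∃ d, HasDerivAt g d t ∧ d ≤ M * f t)
    (hfin : ∫⁻ t in I, ENNReal.ofReal (f t) ≠ ⊤) {a b : ℝ} (ha : a ∈ I) (hb : b ∈ I)
    (hab : a ≤ b) :
    g b - g a ≤ M * (∫⁻ t in I, ENNReal.ofReal (f t)).toReal := by
  have hsub : Icc a b ⊆ I := hI.out ha hb
  have hint : Ioo a b ⊆ interior I :=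
    interior_maximal (Ioo_subset_Icc_self.trans hsub) isOpen_Ioo
  choose! d hd hle using hderiv
  have hfint : IntegrableOn f (Icc a b) := (hf.mono hsub).integrableOn_Icc
  have key := intervalIntegral.sub_le_integral_of_hasDeriv_right_of_le hab (hg.mono hsub)
    (fun x hx => (hd x (hint hx)).hasDerivWithinAt) (hfint.const_mul M)
    (fun x hx => hle x (hint hx))
  rw [intervalIntegral.integral_const_mul, intervalIntegral.integral_of_le hab] at key
  refine key.trans (mul_le_mul_of_nonneg_left ?_ hM)
  rw [← ENNReal.ofReal_le_iff_le_toReal hfin,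
    ofReal_integral_eq_lintegral_ofReal (hfint.mono_set Ioc_subset_Icc_self)
      (Eventually.of_forall hf0)]
  exact lintegral_mono_set (Ioc_subset_Icc_self.trans hsub)

/-- A curve of finite centroaffine length in `H` is bounded, provided that the logarithmic radial
speed of tangent vectors is controlled by the centroaffine norm. -/
lemma exists_norm_le_of_lintegral_ne_top {E : Type*} [NormedAddCommGroup E]
    [InnerProductSpace ℝ E] {h : E → ℝ} {k : ℕ} (hk : k ≠ 0) (hd : ContDiff ℝ 2 h) {H : Set E}
    (hH : ∀ p ∈ H, h p = 1) (h0 : h 0 ≠ 1) {C : ℝ} (hC : 0 ≤ C)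
    (hbound : ∀ p ∈ H, ∀ v, fderiv ℝ h p v = 0 →
      inner ℝ p v ^ 2 ≤ C * ‖p‖ ^ 4 * |fderiv ℝ (fderiv ℝ h) p v v|)
    {I : Set ℝ} (hI : I.OrdConnected) (hIu : UniqueDiffOn ℝ I) {a : ℝ} (ha : IsLeast I a)
    {γ : ℝ → E} (hγ : ContDiffOn ℝ 1 γ I) (hγH : ∀ t ∈ I, γ t ∈ H)
    (hfin : ∫⁻ t in I, ENNReal.ofReal (Real.sqrt |(1 / (k : ℝ)) *
      fderiv ℝ (fderiv ℝ h) (γ t) (derivWithin γ I t) (derivWithin γ I t)|) ≠ ⊤) :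
    ∃ R, ∀ t ∈ I, ‖γ t‖ ≤ R := by
  have hkr : (0 : ℝ) < k := by exact_mod_cast Nat.pos_of_ne_zero hk
  have hd2 : Continuous (fderiv ℝ (fderiv ℝ h)) :=
    (hd.fderiv_right (m := 1) (by norm_num)).continuous_fderiv (by norm_num)
  have hγd : ContinuousOn (derivWithin γ I) I := hγ.continuousOn_derivWithin hIu le_rfl
  have hγ0 (t : ℝ) (ht : t ∈ I) : γ t ≠ 0 := by
    intro h
    exact h0 (h ▸ hH _ (hγH t ht))
  set f : ℝ → ℝ := fun t => Real.sqrt |(1 / (k : ℝ)) *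
      fderiv ℝ (fderiv ℝ h) (γ t) (derivWithin γ I t) (derivWithin γ I t)| with hf
  have hfc : ContinuousOn f I :=
    (continuousOn_const.mul (((hd2.comp_continuousOn hγ.continuousOn).clm_apply hγd).clm_apply
      hγd)).abs.sqrt
  have hgc : ContinuousOn (fun t => Real.log (‖γ t‖ ^ 2)) I :=
    (hγ.continuousOn.norm.pow 2).log fun t ht => by simpa using hγ0 t ht
  have hderiv (t : ℝ) (ht : t ∈ interior I) : ∃ d,
      HasDerivAt (fun t => Real.log (‖γ t‖ ^ 2)) d t ∧ d ≤ 2 * √(C * k) * f t := by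
    have htI := interior_subset ht
    have hIn : I ∈ 𝓝 t := mem_interior_iff_mem_nhds.1 ht
    have hγt : HasDerivAt γ (derivWithin γ I t) t :=
      ((hγ.differentiableOn one_ne_zero t htI).hasDerivWithinAt).hasDerivAt hIn
    have hpos : 0 < ‖γ t‖ := norm_pos_iff.2 (hγ0 t htI)
    refine ⟨_, hγt.norm_sq.log (by positivity), ?_⟩
    have hft : f t = √|(1 / (k : ℝ)) *
      fderiv ℝ (fderiv ℝ h) (γ t) (derivWithin γ I t) (derivWithin γ I t)| := rfl
    rw [hft]
    generalize derivWithin γ I t = v at *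
    have hker : fderiv ℝ h (γ t) v = 0 := by
      have h1 := (hd.differentiable (by norm_num) (γ t)).hasFDerivAt.comp_hasDerivAt t hγt
      refine h1.unique ((hasDerivAt_const t (1 : ℝ)).congr_of_eventuallyEq ?_)
      filter_upwards [hIn] with s hs using hH _ (hγH s hs)
    have hb := hbound _ (hγH t htI) v hker
    rw [div_le_iff₀ (by positivity)]
    have hsq : inner ℝ (γ t) v ^ 2 ≤
        (√(C * k) * √|1 / (k : ℝ) * fderiv ℝ (fderiv ℝ h) (γ t) v v| * ‖γ t‖ ^ 2) ^ 2 := by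
      rw [mul_pow, mul_pow, Real.sq_sqrt (by positivity), Real.sq_sqrt (abs_nonneg _), abs_mul,
        abs_of_pos (one_div_pos.2 hkr)]
      refine hb.trans_eq ?_
      field_simp
    linarith [(le_abs_self _).trans (abs_le_of_sq_le_sq hsq (by positivity))]
  refine ⟨√(Real.exp (Real.log (‖γ a‖ ^ 2) + 2 * √(C * k) *
    (∫⁻ t in I, ENNReal.ofReal (f t)).toReal)), fun t ht => ?_⟩
  have hle := sub_le_mul_lintegral_of_hasDerivAt_le hI hfc (fun t => Real.sqrt_nonneg _) hgc
    (by positivity) hderiv hfin ha.1 ht (ha.2 ht)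
  refine Real.le_sqrt_of_sq_le ?_
  rw [← Real.log_le_iff_le_exp (by have := norm_pos_iff.2 (hγ0 t ht); positivity)]
  linarith

end Length

lemma isClosed_connectedComponentIn {X : Type*} [TopologicalSpace X] {F : Set X} (hF : IsClosed F)
    (x : X) : IsClosed (connectedComponentIn F x) := by
  by_cases hx : x ∈ F
  · refine isClosed_of_closure_subset ?_
    exact isPreconnected_connectedComponentIn.closure.subset_connectedComponentIn
      (subset_closure (mem_connectedComponentIn hx))
      (closure_minimal (connectedComponentIn_subset F x) hF)
  · rw [connectedComponentIn_eq_empty hx]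
    exact isClosed_empty

/-- For a homogeneous polynomial `h` of degree `k ≥ 2` on `ℝ²` and a
locally strictly convex connected component `H` of `{h = 1}` (the Hessian `D²h_p`
is definite on `ker Dh_p` for each `p ∈ H`), every smooth curve `γ : [0,T) → H`
not contained in any compact subset of `H` has infinite centroaffine length; that
is, `H` is complete with respect to the centroaffine metric. -/
theorem stmt_12 (k : ℕ) (hk : 2 ≤ k)
    (P : MvPolynomial (Fin 2) ℝ) (hP : P.IsHomogeneous k)
    (h : EuclideanSpace ℝ (Fin 2) → ℝ)
    (hh : ∀ x, h x = MvPolynomial.eval (fun i => x i) P)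
    (H : Set (EuclideanSpace ℝ (Fin 2)))
    (x₀ : EuclideanSpace ℝ (Fin 2)) (hx₀ : h x₀ = 1)
    (hH : H = connectedComponentIn {x | h x = 1} x₀)
    (hdefinite : ∀ p ∈ H,
      (∀ v : EuclideanSpace ℝ (Fin 2),
        fderiv ℝ h p v = 0 → v ≠ 0 → 0 < fderiv ℝ (fderiv ℝ h) p v v) ∨
      (∀ v : EuclideanSpace ℝ (Fin 2),
        fderiv ℝ h p v = 0 → v ≠ 0 → fderiv ℝ (fderiv ℝ h) p v v < 0)) :
    ∀ T : ℝ≥0∞, 0 < T →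
      ∀ γ : ℝ → EuclideanSpace ℝ (Fin 2),
        ContDiffOn ℝ (⊤ : ℕ∞) γ {t : ℝ | 0 ≤ t ∧ ENNReal.ofReal t < T} →
        (∀ t, 0 ≤ t → ENNReal.ofReal t < T → γ t ∈ H) →
        (¬ ∃ K : Set (EuclideanSpace ℝ (Fin 2)), IsCompact K ∧ K ⊆ H ∧
          γ '' {t : ℝ | 0 ≤ t ∧ ENNReal.ofReal t < T} ⊆ K) →
        ∫⁻ t in {t : ℝ | 0 ≤ t ∧ ENNReal.ofReal t < T},
          ENNReal.ofReal (Real.sqrt |(1 / (k : ℝ)) *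
            fderiv ℝ (fderiv ℝ h) (γ t)
              (derivWithin γ {t : ℝ | 0 ≤ t ∧ ENNReal.ofReal t < T} t)
              (derivWithin γ {t : ℝ | 0 ≤ t ∧ ENNReal.ofReal t < T} t)|) = ⊤ := by
  intro T hT γ hγ hγH hK
  by_contra hfin
  have hk0 : k ≠ 0 := by omega
  have hhe : h = fun x => MvPolynomial.eval (fun i => x i) P := funext hh
  have hd : ContDiff ℝ 2 h := hhe ▸ P.contDiff_eval_euclideanSpace
  have hom (c : ℝ) (x : EuclideanSpace ℝ (Fin 2)) : h (c • x) = c ^ k * h x := by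
    rw [hh, hh]
    exact hP.eval_const_mul c _
  have hline (q e : EuclideanSpace ℝ (Fin 2)) :
      ∃ φ : ℝ[X], φ.natDegree ≤ k ∧ ∀ s : ℝ, h (q + s • e) = φ.eval s := by
    obtain ⟨φ, hdeg, hφ⟩ := MvPolynomial.exists_polynomial_eval_line hP q e
    exact ⟨φ, hdeg, fun s => by rw [← hφ, hh]; rfl⟩
  have hHc : IsClosed H := by
    rw [hH]
    exact isClosed_connectedComponentIn (isClosed_eq hd.continuous continuous_const) _
  have hH1 : ∀ p ∈ H, h p = 1 := by
    rw [hH]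
    exact fun p hp => connectedComponentIn_subset {x | h x = 1} _ hp
  have hnd : ∀ p ∈ H, ∀ v, fderiv ℝ h p v = 0 → v ≠ 0 → fderiv ℝ (fderiv ℝ h) p v v ≠ 0 := by
    intro p hp v hv hv0
    rcases hdefinite p hp with hpos | hneg
    · exact (hpos v hv hv0).ne'
    · exact (hneg v hv hv0).ne
  obtain ⟨C, hC, hbound⟩ := exists_sq_inner_le hk0 hd hom hline hHc hH1 hnd
  have h0 : h 0 ≠ 1 := by
    have := hom 0 0
    rw [zero_smul, zero_pow hk0, zero_mul] at this
    rw [this]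
    exact zero_ne_one
  have hI : {t : ℝ | 0 ≤ t ∧ ENNReal.ofReal t < T}.OrdConnected :=
    ⟨fun x hx y hy z hz => ⟨hx.1.trans hz.1, (ENNReal.ofReal_le_ofReal hz.2).trans_lt hy.2⟩⟩
  have hIu : UniqueDiffOn ℝ {t : ℝ | 0 ≤ t ∧ ENNReal.ofReal t < T} := by
    refine uniqueDiffOn_convex hI.convex ?_
    obtain ⟨r, hr0, hrT⟩ := ENNReal.lt_iff_exists_nnreal_btwn.1 hT
    have hr : (0 : ℝ) < r := by exact_mod_cast hr0
    refine ((nonempty_Ioo.2 hr).mono (interior_maximal (fun x hx => ?_) isOpen_Ioo))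
    refine ⟨hx.1.le, lt_of_le_of_lt ?_ hrT⟩
    rw [← ENNReal.ofReal_coe_nnreal]
    exact ENNReal.ofReal_le_ofReal hx.2.le
  obtain ⟨R, hR⟩ := exists_norm_le_of_lintegral_ne_top hk0 hd hH1 h0 hC hbound hI hIu
    (a := 0) ⟨⟨le_rfl, by simpa using hT⟩, fun t ht => ht.1⟩ (hγ.of_le (by simp))
    (fun t ht => hγH t ht.1 ht.2) hfin
  refine hK ⟨Metric.closedBall 0 R ∩ H, (isCompact_closedBall 0 R).inter_right hHc,
    inter_subset_right, ?_⟩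
  rintro _ ⟨t, ht, rfl⟩
  exact ⟨by simpa using hR t ht, hγH t ht.1 ht.2⟩
end

section
/- Let k > 1, let V ⊆ ℝ^{n+1} be an open set, and let h : V → ℝ be a smooth function positively homogeneous of degree k. Let U ⊆ V be an open cone with (closure of U) \ {0} ⊆ V such that H := {x ∈ U : h(x) = 1} is connected, is a closed subset of ℝ^{n+1}, satisfies U = {λx : λ > 0, x ∈ H}, and D²h_p is negative definite on ker Dh_p for every p ∈ H. Assume the regular boundary behaviour conditions: (i) Dh_p ≠ 0 for every p ∈ ∂U \ {0}; (ii) for every p ∈ ∂U \ {0}, the quadratic form v ↦ −D²h_p(v, v) on ker Dh_p is positive semidefinite and its kernel {v ∈ ker Dh_p : D²h_p(v, w) = 0 for all w ∈ ker Dh_p} equals the line ℝ·p. Then for every T ∈ (0, ∞] every smooth curve γ : [0, T) → H that is not contained in any compact subset of H has infinite centroaffine length ∫₀^T √(−(1/k)·D²h_{γ(t)}(γ'(t), γ'(t))) dt = ∞. -/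
open Set MeasureTheory ENNReal
open Filter Topology

section Homogeneous

variable {E F : Type*} [NormedAddCommGroup E] [NormedSpace ℝ E]
  [NormedAddCommGroup F] [NormedSpace ℝ F] {f : E → F} {V : Set E} {k : ℝ}

lemma fderiv_smul_of_homogeneous (hV : IsOpen V)
    (hf : ∀ l : ℝ, 0 < l → ∀ x ∈ V, l • x ∈ V → f (l • x) = l ^ k • f x)
    (l : ℝ) (hl : 0 < l) (x : E) (hx : x ∈ V) (hlx : l • x ∈ V) :
    fderiv ℝ f (l • x) = l ^ (k - 1) • fderiv ℝ f x := by
  have heq : (fun y ↦ f (l • y)) =ᶠ[𝓝 x] l ^ k • f := by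
    have h2 : ∀ᶠ y in 𝓝 x, l • y ∈ V :=
      (continuous_const_smul l).continuousAt.preimage_mem_nhds (hV.mem_nhds hlx)
    filter_upwards [hV.mem_nhds hx, h2] with y hy hy'
    exact hf l hl y hy hy'
  have h1 := heq.fderiv_eq (𝕜 := ℝ)
  rw [fderiv_comp_smul, fderiv_const_smul_field] at h1
  rw [Real.rpow_sub_one hl.ne', div_eq_inv_mul, mul_smul, ← Pi.smul_apply (l ^ k) (fderiv ℝ f) x, ← h1,
    inv_smul_smul₀ hl.ne']

lemma fderiv_apply_self_of_homogeneous (hV : IsOpen V)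
    (hf : ∀ l : ℝ, 0 < l → ∀ x ∈ V, l • x ∈ V → f (l • x) = l ^ k • f x)
    {x : E} (hx : x ∈ V) (hd : DifferentiableAt ℝ f x) :
    fderiv ℝ f x x = k • f x := by
  have hd' : HasFDerivAt f (fderiv ℝ f x) ((1 : ℝ) • x) := by simpa using hd.hasFDerivAt
  have h1 : HasDerivAt (fun l : ℝ ↦ f (l • x)) (fderiv ℝ f x ((1 : ℝ) • x)) 1 :=
    hd'.comp_hasDerivAt (1 : ℝ) ((hasDerivAt_id (1 : ℝ)).smul_const x)
  have h2 : HasDerivAt (fun l : ℝ ↦ l ^ k • f x) (k • f x) 1 := by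
    simpa using (Real.hasDerivAt_rpow_const (x := 1) (p := k) (by simp)).smul_const (f x)
  have heq : (fun l : ℝ ↦ f (l • x)) =ᶠ[𝓝 1] fun l ↦ l ^ k • f x := by
    have h3 : ∀ᶠ l : ℝ in 𝓝 1, l • x ∈ V :=
      (continuous_id.smul continuous_const).continuousAt.preimage_mem_nhds
        (hV.mem_nhds (by simpa using hx))
    filter_upwards [h3, lt_mem_nhds one_pos] with l hl hl'
    exact hf l hl' x hx hl
  simpa using h1.unique (h2.congr_of_eventuallyEq heq)

end Homogeneous

lemma tendsto_clm_apply {α E F : Type*} [NormedAddCommGroup E] [NormedSpace ℝ E]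
    [NormedAddCommGroup F] [NormedSpace ℝ F] {l : Filter α} {A : α → E →L[ℝ] F} {g : α → E}
    {A₀ : E →L[ℝ] F} {g₀ : E} (hA : Tendsto A l (𝓝 A₀)) (hg : Tendsto g l (𝓝 g₀)) :
    Tendsto (fun z ↦ A z (g z)) l (𝓝 (A₀ g₀)) :=
  (isBoundedBilinearMap_apply.continuous.tendsto (A₀, g₀)).comp (hA.prodMk_nhds hg)

/-- Finsler's lemma, locally uniform in a parameter. -/
lemma eventually_norm_sq_le_of_pos_on_ker {X E F : Type*} [TopologicalSpace X]
    [NormedAddCommGroup E] [NormedSpace ℝ E] [FiniteDimensional ℝ E]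
    [NormedAddCommGroup F] [NormedSpace ℝ F] {Q : X → E →L[ℝ] E →L[ℝ] ℝ} {L : X → E →L[ℝ] F}
    {x₀ : X} (hQ : ContinuousAt Q x₀) (hL : ContinuousAt L x₀)
    (hpos : ∀ u, L x₀ u = 0 → u ≠ 0 → 0 < Q x₀ u u) :
    ∃ M : ℝ, 0 < M ∧ ∀ᶠ x in 𝓝 x₀, ∀ u, ‖u‖ ^ 2 ≤ M * Q x u u + M ^ 2 * ‖L x u‖ ^ 2 := by
  have key : ∀ u ∈ Metric.sphere (0 : E) 1, ∀ᶠ z in (atTop ×ˢ 𝓝 x₀) ×ˢ 𝓝 u,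
      1 ≤ z.1.1 * Q z.1.2 z.2 z.2 + z.1.1 ^ 2 * ‖L z.1.2 z.2‖ ^ 2 := by
    intro u hu
    have hu0 : u ≠ 0 := by rintro rfl; simp at hu
    have tQ : Tendsto (fun z : (ℝ × X) × E ↦ Q z.1.2 z.2 z.2) ((atTop ×ˢ 𝓝 x₀) ×ˢ 𝓝 u)
        (𝓝 (Q x₀ u u)) := by
      have h1 : Tendsto (fun z : (ℝ × X) × E ↦ Q z.1.2) ((atTop ×ˢ 𝓝 x₀) ×ˢ 𝓝 u) (𝓝 (Q x₀)) :=
        hQ.tendsto.comp (tendsto_snd.comp tendsto_fst)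
      exact tendsto_clm_apply (tendsto_clm_apply h1 tendsto_snd) tendsto_snd
    have tL : Tendsto (fun z : (ℝ × X) × E ↦ ‖L z.1.2 z.2‖ ^ 2) ((atTop ×ˢ 𝓝 x₀) ×ˢ 𝓝 u)
        (𝓝 (‖L x₀ u‖ ^ 2)) := by
      have h1 : Tendsto (fun z : (ℝ × X) × E ↦ L z.1.2) ((atTop ×ˢ 𝓝 x₀) ×ˢ 𝓝 u) (𝓝 (L x₀)) :=
        hL.tendsto.comp (tendsto_snd.comp tendsto_fst)
      exact (tendsto_clm_apply h1 tendsto_snd).norm.pow 2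
    have tM : Tendsto (fun z : (ℝ × X) × E ↦ z.1.1) ((atTop ×ˢ 𝓝 x₀) ×ˢ 𝓝 u) atTop :=
      tendsto_fst.comp tendsto_fst
    by_cases hLu : L x₀ u = 0
    · have hq := hpos u hLu hu0
      filter_upwards [(tM.atTop_mul_pos hq tQ).eventually_ge_atTop 1] with z hz
      nlinarith [mul_nonneg (sq_nonneg z.1.1) (sq_nonneg ‖L z.1.2 z.2‖)]
    · have hl : 0 < ‖L x₀ u‖ ^ 2 := by positivity
      have t1 := tQ.add_atTop (tM.atTop_mul_pos hl tL)
      filter_upwards [(tM.atTop_mul_atTop₀ t1).eventually_ge_atTop 1] with z hz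
      linarith
  have h1 : ∀ᶠ z in (atTop ×ˢ 𝓝 x₀) ×ˢ 𝓝ˢ (Metric.sphere (0 : E) 1),
      1 ≤ z.1.1 * Q z.1.2 z.2 z.2 + z.1.1 ^ 2 * ‖L z.1.2 z.2‖ ^ 2 := by
    rw [(isCompact_sphere (0 : E) 1).prod_nhdsSet_eq_biSup]
    simpa only [eventually_iSup] using key
  have h2 := (h1.curry.mono fun _ h ↦ h.self_of_nhdsSet).curry
  obtain ⟨M, hM, hM0⟩ := (h2.and (eventually_gt_atTop 0)).exists
  refine ⟨M, hM0, hM.mono fun x hx u ↦ ?_⟩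
  rcases eq_or_ne u 0 with rfl | hu
  · simp
  have hn : 0 < ‖u‖ := norm_pos_iff.2 hu
  have h3 := hx (‖u‖⁻¹ • u) (by simp [norm_smul, hn.ne'])
  simp only [map_smul, smul_apply, smul_eq_mul, norm_smul, norm_inv, norm_norm] at h3
  have h4 := mul_le_mul_of_nonneg_left h3 (sq_nonneg ‖u‖)
  have : ‖u‖ ^ 2 * (M * (‖u‖⁻¹ * (‖u‖⁻¹ * Q x u u)) + M ^ 2 * (‖u‖⁻¹ * ‖L x u‖) ^ 2)
      = M * Q x u u + M ^ 2 * ‖L x u‖ ^ 2 := by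
    field_simp
  linarith

lemma apply_eq_zero_of_nonneg_of_apply_self_eq_zero {E : Type*} [AddCommGroup E] [Module ℝ E]
    [TopologicalSpace E] [IsTopologicalAddGroup E] [ContinuousSMul ℝ E]
    {Q : E →L[ℝ] E →L[ℝ] ℝ} (hsymm : ∀ v w, Q v w = Q w v) {u w : E}
    (hnonneg : ∀ s : ℝ, 0 ≤ Q (w + s • u) (w + s • u)) (hu : Q u u = 0) : Q u w = 0 := by
  by_contra hne
  have h1 := hnonneg (-(Q w w + 1) / (2 * Q u w))
  simp only [map_add, map_smul, add_apply, smul_apply, smul_eq_mul, hu, hsymm w u] at h1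
  have h2 : -(Q w w + 1) / (2 * Q u w) * Q u w = -(Q w w + 1) / 2 := by field_simp
  linarith

section Estimate

variable {E : Type*} [NormedAddCommGroup E] [InnerProductSpace ℝ E] {V : Set E} {h : E → ℝ} {k : ℝ}

lemma fderiv_fderiv_smul_of_homogeneous (hV : IsOpen V)
    (hf : ∀ l : ℝ, 0 < l → ∀ x ∈ V, l • x ∈ V → h (l • x) = l ^ k * h x)
    {l : ℝ} (hl : 0 < l) {x : E} (hx : x ∈ V) (hlx : l • x ∈ V) :
    fderiv ℝ (fderiv ℝ h) (l • x) = l ^ (k - 2) • fderiv ℝ (fderiv ℝ h) x := by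
  rw [fderiv_smul_of_homogeneous hV (fderiv_smul_of_homogeneous hV hf) l hl x hx hlx]
  ring_nf

lemma fderiv_fderiv_add_smul_self (hV : IsOpen V)
    (hf : ∀ l : ℝ, 0 < l → ∀ x ∈ V, l • x ∈ V → h (l • x) = l ^ k * h x)
    {x : E} (hx : x ∈ V) (hd : ContDiffAt ℝ 2 h x) {a : ℝ} {u : E}
    (hu : fderiv ℝ h x (a • x + u) = 0) :
    fderiv ℝ h x u = -(a * k * h x) ∧
    fderiv ℝ (fderiv ℝ h) x (a • x + u) (a • x + u)
      = fderiv ℝ (fderiv ℝ h) x u u - a ^ 2 * k * (k - 1) * h x := by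
  have e1 : fderiv ℝ h x x = k * h x :=
    fderiv_apply_self_of_homogeneous hV hf hx (hd.differentiableAt (by norm_num))
  have e2 : fderiv ℝ (fderiv ℝ h) x x = (k - 1) • fderiv ℝ h x :=
    fderiv_apply_self_of_homogeneous hV (fderiv_smul_of_homogeneous hV hf) hx
      ((hd.fderiv_right (m := 1) (by norm_num)).differentiableAt (by norm_num))
  have e3 : fderiv ℝ (fderiv ℝ h) x u x = fderiv ℝ (fderiv ℝ h) x x u :=
    hd.isSymmSndFDerivAt (by simp) u x
  have e4 : fderiv ℝ h x u = -(a * k * h x) := by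
    simp only [map_add, map_smul, smul_eq_mul, e1] at hu
    linarith
  refine ⟨e4, ?_⟩
  simp only [map_add, map_smul, add_apply, smul_apply, smul_eq_mul, e3, e2, e1, e4]
  ring

lemma inner_sq_le_of_sphere_bound (hV : IsOpen V)
    (hf : ∀ l : ℝ, 0 < l → ∀ x ∈ V, l • x ∈ V → h (l • x) = l ^ k * h x)
    {U : Set E} (hUV : U ⊆ V) (hUcone : ∀ l : ℝ, 0 < l → ∀ x ∈ U, l • x ∈ U) {C : ℝ}
    (hC : ∀ x ∈ U, ‖x‖ = 1 → ∀ w, fderiv ℝ h x w = 0 →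
      h x * inner ℝ x w ^ 2 ≤ C * -(fderiv ℝ (fderiv ℝ h) x w w))
    {p : E} (hp : p ∈ U) (hp0 : p ≠ 0) (hp1 : h p = 1) {v : E} (hv : fderiv ℝ h p v = 0) :
    inner ℝ p v ^ 2 ≤ C * ‖p‖ ^ 4 * -(fderiv ℝ (fderiv ℝ h) p v v) := by
  have hn : 0 < ‖p‖ := norm_pos_iff.2 hp0
  have hl : 0 < ‖p‖⁻¹ := inv_pos.2 hn
  have hx : ‖p‖⁻¹ • p ∈ U := hUcone _ hl p hp
  have h1 := hC _ hx (by simp [norm_smul, hn.ne']) v (by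
    rw [fderiv_smul_of_homogeneous hV hf _ hl p (hUV hp) (hUV hx)]
    simp [hv])
  rw [fderiv_fderiv_smul_of_homogeneous hV hf hl (hUV hp) (hUV hx),
    hf _ hl p (hUV hp) (hUV hx), hp1, Real.rpow_sub hl, real_inner_smul_left] at h1
  simp only [smul_apply, smul_eq_mul, Real.rpow_two] at h1
  have hk : 0 < ‖p‖⁻¹ ^ k := Real.rpow_pos_of_pos hl k
  have h2 := mul_le_mul_of_nonneg_left h1 (by positivity : 0 ≤ (‖p‖⁻¹ ^ k)⁻¹ * ‖p‖ ^ 2)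
  have e1 : (‖p‖⁻¹ ^ k)⁻¹ * ‖p‖ ^ 2 * (‖p‖⁻¹ ^ k * 1 * (‖p‖⁻¹ * inner ℝ p v) ^ 2)
      = inner ℝ p v ^ 2 := by
    generalize ‖p‖⁻¹ ^ k = q at hk
    field_simp
  have e2 : (‖p‖⁻¹ ^ k)⁻¹ * ‖p‖ ^ 2 *
      (C * -(‖p‖⁻¹ ^ k / ‖p‖⁻¹ ^ 2 * fderiv ℝ (fderiv ℝ h) p v v))
      = C * ‖p‖ ^ 4 * -(fderiv ℝ (fderiv ℝ h) p v v) := by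
    generalize ‖p‖⁻¹ ^ k = q at hk
    field_simp
  linarith

variable [FiniteDimensional ℝ E]

lemma eventually_mul_inner_sq_le_of_negDef {x₀ : E} (hd : ContDiffAt ℝ 2 h x₀)
    (hneg : ∀ v, fderiv ℝ h x₀ v = 0 → v ≠ 0 → fderiv ℝ (fderiv ℝ h) x₀ v v < 0) :
    ∃ C : ℝ, 0 < C ∧ ∀ᶠ x in 𝓝 x₀, ‖x‖ = 1 → 0 ≤ h x → ∀ w, fderiv ℝ h x w = 0 →
      h x * inner ℝ x w ^ 2 ≤ C * -(fderiv ℝ (fderiv ℝ h) x w w) := by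
  have hd1 : ContDiffAt ℝ 1 (fderiv ℝ h) x₀ := hd.fderiv_right (by norm_num)
  have hd2 : ContDiffAt ℝ 0 (fderiv ℝ (fderiv ℝ h)) x₀ := hd1.fderiv_right (by norm_num)
  obtain ⟨M, hM, hev⟩ := eventually_norm_sq_le_of_pos_on_ker
    (Q := fun x ↦ -fderiv ℝ (fderiv ℝ h) x) (L := fderiv ℝ h) (x₀ := x₀)
    hd2.continuousAt.neg hd1.continuousAt (fun u hu hu0 ↦ by simpa using hneg u hu hu0)
  have hlt : ∀ᶠ x in 𝓝 x₀, h x < |h x₀| + 1 :=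
    hd.continuousAt.eventually_lt_const (by linarith [le_abs_self (h x₀)])
  refine ⟨(|h x₀| + 1) * M, by positivity, ?_⟩
  filter_upwards [hev, hlt] with x hx hxlt hx1 hx0 w hw
  have h1 := hx w
  simp only [hw, neg_apply, norm_zero] at h1
  have h2 : inner ℝ x w ^ 2 ≤ ‖w‖ ^ 2 := by
    have := abs_real_inner_le_norm x w
    rw [hx1, one_mul] at this
    exact sq_le_sq.2 (by simpa using this)
  calc h x * inner ℝ x w ^ 2 ≤ (|h x₀| + 1) * ‖w‖ ^ 2 := by gcongr
    _ ≤ (|h x₀| + 1) * (M * -(fderiv ℝ (fderiv ℝ h) x w w)) := by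
      gcongr
      linarith
    _ = _ := by ring

lemma eventually_mul_inner_sq_le_of_regular (hk : 1 < k) (hV : IsOpen V)
    (hf : ∀ l : ℝ, 0 < l → ∀ x ∈ V, l • x ∈ V → h (l • x) = l ^ k * h x)
    {x₀ : E} (hx₀ : x₀ ∈ V) (hx₀0 : x₀ ≠ 0) (hd : ContDiffAt ℝ 2 h x₀) (hh : h x₀ = 0)
    (hpsd : ∀ v, fderiv ℝ h x₀ v = 0 → 0 ≤ -(fderiv ℝ (fderiv ℝ h) x₀ v v))
    (hker : ∀ v, fderiv ℝ h x₀ v = 0 →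
      (∀ w, fderiv ℝ h x₀ w = 0 → fderiv ℝ (fderiv ℝ h) x₀ v w = 0) → ∃ c : ℝ, v = c • x₀) :
    ∃ C : ℝ, 0 < C ∧ ∀ᶠ x in 𝓝 x₀, ‖x‖ = 1 → 0 ≤ h x → ∀ w, fderiv ℝ h x w = 0 →
      h x * inner ℝ x w ^ 2 ≤ C * -(fderiv ℝ (fderiv ℝ h) x w w) := by
  have hd1 : ContDiffAt ℝ 1 (fderiv ℝ h) x₀ := hd.fderiv_right (by norm_num)
  have hd2 : ContDiffAt ℝ 0 (fderiv ℝ (fderiv ℝ h)) x₀ := hd1.fderiv_right (by norm_num)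
  have hsymm : ∀ v w, fderiv ℝ (fderiv ℝ h) x₀ v w = fderiv ℝ (fderiv ℝ h) x₀ w v :=
    hd.isSymmSndFDerivAt (by simp)
  have hLcont : ContinuousAt (fun x ↦ (fderiv ℝ h x).prod (innerSL ℝ x)) x₀ :=
    (ContinuousLinearMap.prodₗᵢ ℝ).continuous.continuousAt.comp
      (hd1.continuousAt.prodMk (innerSL ℝ).continuous.continuousAt)
  obtain ⟨M, hM, hev⟩ := eventually_norm_sq_le_of_pos_on_ker
    (Q := fun x ↦ -fderiv ℝ (fderiv ℝ h) x) (L := fun x ↦ (fderiv ℝ h x).prod (innerSL ℝ x))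
    (x₀ := x₀) hd2.continuousAt.neg hLcont (by
      intro u hu hu0
      obtain ⟨hu1, hu2⟩ : fderiv ℝ h x₀ u = 0 ∧ inner ℝ x₀ u = 0 := by simpa using hu
      refine lt_of_le_of_ne (hpsd u hu1) fun hne ↦ hu0 ?_
      obtain ⟨c, rfl⟩ := hker u hu1 fun w hw ↦ by
        have := apply_eq_zero_of_nonneg_of_apply_self_eq_zero
          (Q := -fderiv ℝ (fderiv ℝ h) x₀) (u := u) (w := w) (by simpa using hsymm)
          (fun s ↦ hpsd _ (by simp [hw, hu1])) hne.symm
        simpa using this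
      simpa [inner_smul_right, hx₀0] using hu2)
  have hlt : ∀ᶠ x in 𝓝 x₀, h x < (k - 1) / (2 * M * k) :=
    hd.continuousAt.eventually_lt_const (by rw [hh]; apply div_pos <;> nlinarith)
  have hdx : ∀ᶠ x in 𝓝 x₀, ContDiffAt ℝ 2 h x := hd.eventually (by simp)
  refine ⟨2 / (k * (k - 1)), by apply div_pos <;> nlinarith, ?_⟩
  filter_upwards [hev, hlt, hdx, hV.mem_nhds hx₀] with x hx hxlt hxd hxV hx1 hx0 w hw
  obtain ⟨a, ha⟩ : ∃ a : ℝ, inner ℝ x w = a := ⟨_, rfl⟩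
  rw [ha]
  obtain ⟨u, rfl⟩ : ∃ u, w = a • x + u := ⟨w - a • x, by abel⟩
  have hau : inner ℝ x u = 0 := by
    have : inner ℝ x (a • x + u) = a + inner ℝ x u := by
      simp [inner_add_right, inner_smul_right, hx1]
    linarith
  obtain ⟨e1, e2⟩ := fderiv_fderiv_add_smul_self hV hf hxV hxd hw
  have h1 := hx u
  simp only [neg_apply, ContinuousLinearMap.prod_apply, innerSL_apply_apply, hau, e1,
    Prod.norm_mk, norm_zero, Real.norm_eq_abs] at h1
  rw [max_eq_left (abs_nonneg _), sq_abs] at h1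
  have h2 : 0 ≤ -(fderiv ℝ (fderiv ℝ h) x u u) + M * (a * k * h x) ^ 2 := by
    refine nonneg_of_mul_nonneg_right ?_ hM
    nlinarith [sq_nonneg ‖u‖]
  have h3 : h x * (2 * M * k) ≤ k - 1 := ((lt_div_iff₀ (by nlinarith)).1 hxlt).le
  rw [e2, div_mul_eq_mul_div, le_div_iff₀ (by nlinarith)]
  have h4 : 0 ≤ (k - 1 - h x * (2 * M * k)) * (a ^ 2 * k * h x) :=
    mul_nonneg (by linarith) (mul_nonneg (by nlinarith [sq_nonneg a]) hx0)
  nlinarith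

lemma exists_mul_inner_sq_le (hk : 1 < k) (hV : IsOpen V) (hd : ∀ x ∈ V, ContDiffAt ℝ 2 h x)
    (hf : ∀ l : ℝ, 0 < l → ∀ x ∈ V, l • x ∈ V → h (l • x) = l ^ k * h x)
    {U : Set E} (hUopen : IsOpen U) (hUV : U ⊆ V)
    (hUcone : ∀ l : ℝ, 0 < l → ∀ x ∈ U, l • x ∈ U) (hclosV : closure U \ {0} ⊆ V)
    (hpos : ∀ x ∈ U, 0 < h x) (hclosed : IsClosed {x ∈ U | h x = 1})
    (hneg : ∀ p ∈ U, ∀ v, fderiv ℝ h p v = 0 → v ≠ 0 → fderiv ℝ (fderiv ℝ h) p v v < 0)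
    (hpsd : ∀ p ∈ frontier U \ {0}, ∀ v, fderiv ℝ h p v = 0 →
      0 ≤ -(fderiv ℝ (fderiv ℝ h) p v v))
    (hker : ∀ p ∈ frontier U \ {0}, ∀ v, fderiv ℝ h p v = 0 →
      (∀ w, fderiv ℝ h p w = 0 → fderiv ℝ (fderiv ℝ h) p v w = 0) → ∃ c : ℝ, v = c • p) :
    ∃ C : ℝ, 0 < C ∧ ∀ x ∈ U, ‖x‖ = 1 → ∀ w, fderiv ℝ h x w = 0 →
      h x * inner ℝ x w ^ 2 ≤ C * -(fderiv ℝ (fderiv ℝ h) x w w) := by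
  have hloc : ∀ x₀ ∈ closure U ∩ Metric.sphere 0 1, ∃ C : ℝ, 0 < C ∧ ∀ᶠ x in 𝓝 x₀,
      ‖x‖ = 1 → 0 ≤ h x → ∀ w, fderiv ℝ h x w = 0 →
        h x * inner ℝ x w ^ 2 ≤ C * -(fderiv ℝ (fderiv ℝ h) x w w) := by
    rintro x₀ ⟨hx₀, hx₀1⟩
    have hx₀0 : x₀ ≠ 0 := by rintro rfl; simp at hx₀1
    have hx₀V : x₀ ∈ V := hclosV ⟨hx₀, hx₀0⟩
    by_cases hU : x₀ ∈ U
    · exact eventually_mul_inner_sq_le_of_negDef (hd x₀ hx₀V) (hneg x₀ hU)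
    have hfr : x₀ ∈ frontier U \ {0} := ⟨⟨hx₀, by rwa [hUopen.interior_eq]⟩, hx₀0⟩
    have hcont : ContinuousAt h x₀ := (hd x₀ hx₀V).continuousAt
    refine eventually_mul_inner_sq_le_of_regular hk hV hf hx₀V hx₀0 (hd x₀ hx₀V) ?_
      (hpsd x₀ hfr) (hker x₀ hfr)
    have hfreq : ∃ᶠ x in 𝓝 x₀, x ∈ U := mem_closure_iff_frequently.1 hx₀
    by_contra hne
    rcases lt_or_gt_of_ne hne with hlt | hgt
    · obtain ⟨x, hxU, hx⟩ := (hfreq.and_eventually (hcont.eventually_lt_const hlt)).exists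
      exact (hpos x hxU).not_gt hx
    · have hc : ContinuousAt (fun x ↦ (h x ^ (-k⁻¹)) • x) x₀ :=
        (hcont.rpow_const (Or.inl hgt.ne')).smul continuousAt_id
      have hmem : (h x₀ ^ (-k⁻¹)) • x₀ ∈ {x ∈ U | h x = 1} := by
        refine hclosed.mem_of_frequently_of_tendsto (hfreq.mono fun x hx ↦ ?_) hc
        have hp := Real.rpow_pos_of_pos (hpos x hx) (-k⁻¹)
        refine ⟨hUcone _ hp x hx, ?_⟩
        rw [hf _ hp x (hUV hx) (hUV (hUcone _ hp x hx)), ← Real.rpow_mul (hpos x hx).le,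
          neg_mul, inv_mul_cancel₀ (by linarith), Real.rpow_neg_one,
          inv_mul_cancel₀ (hpos x hx).ne']
      have hp := Real.rpow_pos_of_pos hgt (-k⁻¹)
      have := hUcone _ (inv_pos.2 hp) _ hmem.1
      rw [inv_smul_smul₀ hp.ne'] at this
      exact hU this
  have hcomp : IsCompact (closure U ∩ Metric.sphere (0 : E) 1) :=
    (isCompact_sphere 0 1).inter_left isClosed_closure
  obtain ⟨C, hC, hCb⟩ := hcomp.induction_on
    (p := fun s ↦ ∃ C : ℝ, 0 < C ∧ ∀ x ∈ s, ‖x‖ = 1 → 0 ≤ h x → ∀ w, fderiv ℝ h x w = 0 →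
      h x * inner ℝ x w ^ 2 ≤ C * -(fderiv ℝ (fderiv ℝ h) x w w))
    ⟨1, one_pos, by simp⟩
    (fun s t hst ⟨C, hC, hb⟩ ↦ ⟨C, hC, fun x hx ↦ hb x (hst hx)⟩)
    (by
      rintro s t ⟨C, hC, hb⟩ ⟨D, hD, hb'⟩
      refine ⟨C + D, by positivity, fun x hx hx1 hx0 w hw ↦ ?_⟩
      have haux : ∀ B : ℝ, 0 < B → h x * inner ℝ x w ^ 2 ≤ B * -(fderiv ℝ (fderiv ℝ h) x w w) →
          0 ≤ -(fderiv ℝ (fderiv ℝ h) x w w) := fun B hB hle ↦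
        nonneg_of_mul_nonneg_right ((mul_nonneg hx0 (sq_nonneg _)).trans hle) hB
      rw [add_mul]
      rcases hx with hx | hx
      · have hle := hb x hx hx1 hx0 w hw
        nlinarith [haux C hC hle]
      · have hle := hb' x hx hx1 hx0 w hw
        nlinarith [haux D hD hle])
    (fun x hx ↦ by
      obtain ⟨C, hC, hev⟩ := hloc x hx
      exact ⟨_, mem_nhdsWithin_of_mem_nhds hev, C, hC, fun y hy ↦ hy⟩)
  exact ⟨C, hC, fun x hx hx1 ↦ hCb x ⟨subset_closure hx, by simpa using hx1⟩ hx1 (hpos x hx).le⟩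

end Estimate

/-- If the logarithmic derivative of `‖γ‖` is integrably bounded, then `γ` is bounded. -/
lemma exists_norm_le_of_lintegral_ne_top_s13 {E : Type*} [NormedAddCommGroup E]
    [InnerProductSpace ℝ E] {γ : ℝ → E} {I : Set ℝ} {G : ℝ → ℝ≥0∞}
    (hI : ∀ s ∈ I, Icc 0 s ⊆ I) (hI0 : ∀ s ∈ I, 0 ≤ s) (hγ : ContDiffOn ℝ 1 γ I)
    (hγ0 : ∀ t ∈ I, γ t ≠ 0) (hG : ∫⁻ t in I, G t ≠ ⊤)
    (hb : ∀ t ∈ interior I,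
      ENNReal.ofReal |2 * inner ℝ (γ t) (derivWithin γ I t) / ‖γ t‖ ^ 2| ≤ G t) :
    ∃ R : ℝ, ∀ s ∈ I, ‖γ s‖ ≤ R := by
  set B := (∫⁻ t in I, G t).toReal
  have hmain : ∀ s ∈ I, Real.log (‖γ s‖ ^ 2) - Real.log (‖γ 0‖ ^ 2) ≤ B := by
    intro s hs
    have hfd : ContDiffOn ℝ 1 (fun t ↦ Real.log (‖γ t‖ ^ 2)) (Icc 0 s) :=
      ((hγ.norm_sq ℝ).log fun t ht ↦ by simpa using hγ0 t ht).mono (hI s hs)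
    have h1 := enorm_sub_le_lintegral_deriv_of_contDiffOn_Icc hfd (hI0 s hs)
    have h2 : ∫⁻ t in Icc 0 s, ‖deriv (fun t ↦ Real.log (‖γ t‖ ^ 2)) t‖ₑ ≤ ∫⁻ t in I, G t := by
      rw [← setLIntegral_congr Ioo_ae_eq_Icc]
      refine (setLIntegral_mono' measurableSet_Ioo fun t ht ↦ ?_).trans
        (lintegral_mono_set (Ioo_subset_Icc_self.trans (hI s hs)))
      have hIt : t ∈ interior I :=
        interior_mono (hI s hs) (by rwa [interior_Icc])
      have hγt : HasDerivAt γ (derivWithin γ I t) t :=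
        ((hγ.differentiableOn (by norm_num) t (interior_subset hIt)).hasDerivWithinAt).hasDerivAt
          (mem_interior_iff_mem_nhds.1 hIt)
      have hd := hγt.norm_sq.log (by simpa using hγ0 t (interior_subset hIt))
      rw [hd.deriv, Real.enorm_eq_ofReal_abs]
      exact hb t hIt
    have h3 := ENNReal.toReal_mono hG (h1.trans h2)
    rw [Real.enorm_eq_ofReal_abs, ENNReal.toReal_ofReal (abs_nonneg _)] at h3
    exact (le_abs_self _).trans h3
  refine ⟨Real.sqrt (Real.exp (B + Real.log (‖γ 0‖ ^ 2))), fun s hs ↦ Real.le_sqrt_of_sq_le ?_⟩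
  have hp : 0 < ‖γ s‖ ^ 2 := by
    have := norm_pos_iff.2 (hγ0 s hs)
    positivity
  rw [← Real.log_le_iff_le_exp hp]
  linarith [hmain s hs]

/-- completeness under regular boundary behaviour: Let `h` be smooth
on an open set `V ⊆ ℝ^{n+1}` and positively homogeneous of degree `k > 1`, let
`U ⊆ V` be an open cone with `closure U \ {0} ⊆ V` such that
`H = {x ∈ U | h x = 1}` is connected, closed in `ℝ^{n+1}`, satisfies
`U = ℝ^{>0}·H`, and is hyperbolic (`D²h_p` negative definite on `ker Dh_p` for
`p ∈ H`). Assume regular boundary behaviour: (i) `Dh_p ≠ 0` on `∂U \ {0}`;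
(ii) `−D²h_p` is positive semidefinite on `ker Dh_p` with kernel exactly `ℝ·p`,
for every `p ∈ ∂U \ {0}`. Then every smooth curve `γ : [0,T) → H` not contained in
any compact subset of `H` has infinite centroaffine length. -/
theorem stmt_13 (n : ℕ) (k : ℝ) (hk : 1 < k)
    (V : Set (EuclideanSpace ℝ (Fin (n + 1)))) (hVopen : IsOpen V)
    (h : EuclideanSpace ℝ (Fin (n + 1)) → ℝ)
    (hsmooth : ContDiffOn ℝ (⊤ : ℕ∞) h V)
    (hhomog : ∀ l : ℝ, 0 < l → ∀ x ∈ V, l • x ∈ V → h (l • x) = l ^ k * h x)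
    (U : Set (EuclideanSpace ℝ (Fin (n + 1)))) (hUopen : IsOpen U) (hUV : U ⊆ V)
    (hUcone : ∀ l : ℝ, 0 < l → ∀ x ∈ U, l • x ∈ U)
    (hclosV : closure U \ {0} ⊆ V)
    (H : Set (EuclideanSpace ℝ (Fin (n + 1))))
    (hHdef : H = {x ∈ U | h x = 1})
    (hHconn : IsConnected H)
    (hHclosed : IsClosed H)
    (hUH : U = {y | ∃ l : ℝ, 0 < l ∧ ∃ x ∈ H, y = l • x})
    (hhyp : ∀ p ∈ H, ∀ v : EuclideanSpace ℝ (Fin (n + 1)),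
      fderiv ℝ h p v = 0 → v ≠ 0 → fderiv ℝ (fderiv ℝ h) p v v < 0)
    (hreg1 : ∀ p ∈ frontier U \ {0}, fderiv ℝ h p ≠ 0)
    (hreg2 : ∀ p ∈ frontier U \ {0},
      (∀ v : EuclideanSpace ℝ (Fin (n + 1)), fderiv ℝ h p v = 0 →
        0 ≤ -(fderiv ℝ (fderiv ℝ h) p v v)) ∧
      {v : EuclideanSpace ℝ (Fin (n + 1)) | fderiv ℝ h p v = 0 ∧
          ∀ w : EuclideanSpace ℝ (Fin (n + 1)), fderiv ℝ h p w = 0 →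
            fderiv ℝ (fderiv ℝ h) p v w = 0}
        = {v | ∃ c : ℝ, v = c • p}) :
    ∀ T : ℝ≥0∞, 0 < T →
      ∀ γ : ℝ → EuclideanSpace ℝ (Fin (n + 1)),
        ContDiffOn ℝ (⊤ : ℕ∞) γ {t : ℝ | 0 ≤ t ∧ ENNReal.ofReal t < T} →
        (∀ t, 0 ≤ t → ENNReal.ofReal t < T → γ t ∈ H) →
        (¬ ∃ K : Set (EuclideanSpace ℝ (Fin (n + 1))), IsCompact K ∧ K ⊆ H ∧
          γ '' {t : ℝ | 0 ≤ t ∧ ENNReal.ofReal t < T} ⊆ K) →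
        ∫⁻ t in {t : ℝ | 0 ≤ t ∧ ENNReal.ofReal t < T},
          ENNReal.ofReal (Real.sqrt (-(1 / k) *
            fderiv ℝ (fderiv ℝ h) (γ t)
              (derivWithin γ {t : ℝ | 0 ≤ t ∧ ENNReal.ofReal t < T} t)
              (derivWithin γ {t : ℝ | 0 ≤ t ∧ ENNReal.ofReal t < T} t))) = ⊤ := by
  intro T hT γ hγ hγH hesc
  subst hHdef
  set I : Set ℝ := {t : ℝ | 0 ≤ t ∧ ENNReal.ofReal t < T}
  have hd : ∀ x ∈ V, ContDiffAt ℝ 2 h x := fun x hx ↦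
    (hsmooth.contDiffAt (hVopen.mem_nhds hx)).of_le (WithTop.coe_le_coe.2 (le_top : (2 : ℕ∞) ≤ ⊤))
  have hHne : ∀ p ∈ {x ∈ U | h x = 1}, p ≠ 0 := by
    rintro p ⟨hpU, hp1⟩ rfl
    have h2 := hhomog 2 two_pos 0 (hUV hpU) (by simpa using hUV hpU)
    rw [smul_zero, hp1, mul_one] at h2
    exact (Real.one_lt_rpow one_lt_two (by linarith : 0 < k)).ne h2
  have hUrep : ∀ p ∈ U, ∃ l : ℝ, 0 < l ∧ ∃ x ∈ {x ∈ U | h x = 1}, p = l • x := fun p hp ↦ by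
    rw [hUH] at hp
    exact hp
  have hpos : ∀ x ∈ U, 0 < h x := fun x hx ↦ by
    obtain ⟨l, hl, y, ⟨hyU, hy1⟩, rfl⟩ := hUrep x hx
    rw [hhomog l hl y (hUV hyU) (hUV hx), hy1, mul_one]
    exact Real.rpow_pos_of_pos hl k
  have hneg : ∀ p ∈ U, ∀ v, fderiv ℝ h p v = 0 → v ≠ 0 →
      fderiv ℝ (fderiv ℝ h) p v v < 0 := fun x hx v hv hv0 ↦ by
    obtain ⟨l, hl, y, hy, rfl⟩ := hUrep x hx
    have hp1 := Real.rpow_pos_of_pos hl (k - 1)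
    have hp2 := Real.rpow_pos_of_pos hl (k - 2)
    rw [fderiv_smul_of_homogeneous hVopen hhomog l hl y (hUV hy.1) (hUV hx), smul_apply,
      smul_eq_mul, mul_eq_zero, or_iff_right hp1.ne'] at hv
    rw [fderiv_fderiv_smul_of_homogeneous hVopen hhomog hl (hUV hy.1) (hUV hx)]
    exact mul_neg_of_pos_of_neg hp2 (hhyp y hy v hv hv0)
  obtain ⟨C, hC, hCb⟩ := exists_mul_inner_sq_le hk hVopen hd hhomog hUopen hUV hUcone hclosV hpos
    hHclosed hneg (fun p hp ↦ (hreg2 p hp).1)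
    (fun p hp v hv hw ↦ (hreg2 p hp).2.subset ⟨hv, hw⟩)
  by_contra hfin
  have hI0 : ∀ t ∈ I, γ t ∈ {x ∈ U | h x = 1} := fun t ht ↦ hγH t ht.1 ht.2
  obtain ⟨R, hR⟩ := exists_norm_le_of_lintegral_ne_top_s13 (γ := γ) (I := I)
    (G := fun t ↦ ENNReal.ofReal (2 * Real.sqrt (C * k)) * ENNReal.ofReal (Real.sqrt (-(1 / k) *
      fderiv ℝ (fderiv ℝ h) (γ t) (derivWithin γ I t) (derivWithin γ I t))))
    (fun s hs t ht ↦ ⟨ht.1, (ENNReal.ofReal_le_ofReal ht.2).trans_lt hs.2⟩) (fun s hs ↦ hs.1)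
    (hγ.of_le (by exact_mod_cast le_top)) (fun t ht ↦ hHne _ (hI0 t ht))
    (by
      rw [lintegral_const_mul' _ _ ofReal_ne_top]
      exact ENNReal.mul_ne_top ofReal_ne_top hfin)
    (fun t ht ↦ by
      have htI := interior_subset ht
      have hnhds : I ∈ 𝓝 t := mem_interior_iff_mem_nhds.1 ht
      have hγt : HasDerivAt γ (derivWithin γ I t) t :=
        ((hγ.differentiableOn (by simp) t htI).hasDerivWithinAt).hasDerivAt hnhds
      have hp := hI0 t htI
      have htan : fderiv ℝ h (γ t) (derivWithin γ I t) = 0 := by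
        have h1 : HasDerivAt (fun s ↦ h (γ s)) (fderiv ℝ h (γ t) (derivWithin γ I t)) t :=
          ((hd _ (hUV hp.1)).differentiableAt (by norm_num)).hasFDerivAt.comp_hasDerivAt t hγt
        have h2 : (fun s ↦ h (γ s)) =ᶠ[𝓝 t] fun _ ↦ 1 :=
          Filter.mem_of_superset hnhds fun s hs ↦ (hI0 s hs).2
        exact h1.unique ((hasDerivAt_const t (1 : ℝ)).congr_of_eventuallyEq h2)
      have hle := inner_sq_le_of_sphere_bound hVopen hhomog hUV hUcone hCb hp.1 (hHne _ hp) hp.2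
        htan
      have hn : 0 < ‖γ t‖ := norm_pos_iff.2 (hHne _ hp)
      rw [← ENNReal.ofReal_mul (by positivity), mul_assoc, ← Real.sqrt_mul (by positivity)]
      refine ENNReal.ofReal_le_ofReal ?_
      rw [mul_div_assoc, abs_mul, abs_two]
      gcongr
      refine Real.abs_le_sqrt ?_
      rw [div_pow, div_le_iff₀ (by positivity)]
      refine hle.trans_eq ?_
      field_simp)
  refine hesc ⟨{x ∈ U | h x = 1} ∩ Metric.closedBall 0 R,
    (isCompact_closedBall 0 R).inter_left hHclosed, inter_subset_left, ?_⟩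
  rintro _ ⟨t, ht, rfl⟩
  exact ⟨hI0 t ht, by simpa using hR t ht⟩
end

section
/- Let n ≥ 1, let h be a homogeneous cubic polynomial on ℝ^{n+1}, and let H be a nonempty connected component of {x ∈ ℝ^{n+1} : h(x) = 1} such that for every p ∈ H the restriction of the Hessian D²h_p to ker Dh_p is definite (positive definite or negative definite). Then for every p ∈ H the restriction of D²h_p to ker Dh_p is negative definite; i.e., H is hyperbolic (the centroaffine metric −(1/3)·D²h is positive definite on tangent spaces) and not elliptic. -/
open Set

open MvPolynomial in
theorem contDiff_eval_coord {ι : Type*} [Fintype ι] (P : MvPolynomial ι ℝ) :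
    ContDiff ℝ 2 (fun x : EuclideanSpace ℝ ι => eval (fun i => x i) P) := by
  simp only [eval_eq']
  refine ContDiff.sum fun d _ => contDiff_const.mul (contDiff_prod fun i _ => ?_)
  exact ContDiff.pow (by fun_prop) _

theorem MvPolynomial.IsHomogeneous.eval_mul_left {ι R : Type*} [Fintype ι] [CommSemiring R]
    {P : MvPolynomial ι R} {k : ℕ} (hP : P.IsHomogeneous k) (r : R) (x : ι → R) :
    MvPolynomial.eval (fun i => r * x i) P = r ^ k * MvPolynomial.eval x P := by
  rw [MvPolynomial.eval_eq', MvPolynomial.eval_eq', Finset.mul_sum]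
  refine Finset.sum_congr rfl fun d hd => ?_
  have hdeg : ∑ i, d i = k := by
    rw [← Finsupp.degree_eq_sum, Finsupp.degree_eq_weight_one]
    exact hP (MvPolynomial.mem_support_iff.mp hd)
  simp only [mul_pow, Finset.prod_mul_distrib, Finset.prod_pow_eq_pow_sum, hdeg]
  ring

theorem MvPolynomial.IsHomogeneous.exists_eval_line_eq {ι : Type*} {P : MvPolynomial ι ℝ}
    (hP : P.IsHomogeneous 3) (p v : ι → ℝ) :
    ∃ a b c d : ℝ, ∀ t : ℝ,
      MvPolynomial.eval (fun i => p i + t * v i) P = a + b * t + c * t ^ 2 + d * t ^ 3 := by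
  let f : Polynomial ℝ :=
    MvPolynomial.aeval (fun i => Polynomial.C (p i) + Polynomial.C (v i) * Polynomial.X) P
  have hdeg : f.natDegree < 4 := by
    have := MvPolynomial.aeval_natDegree_le (n := 1) P hP.totalDegree_le
      (fun i => Polynomial.C (p i) + Polynomial.C (v i) * Polynomial.X) (fun i => by compute_degree)
    exact Nat.lt_succ_of_le this
  refine ⟨f.coeff 0, f.coeff 1, f.coeff 2, f.coeff 3, fun t => ?_⟩
  have heval : f.eval t = MvPolynomial.eval (fun i => p i + t * v i) P := by
    have := MvPolynomial.map_aeval (fun i => Polynomial.C (p i) + Polynomial.C (v i) * Polynomial.X)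
      (Polynomial.evalRingHom t) P
    have hring : (Polynomial.evalRingHom t).comp (algebraMap ℝ (Polynomial ℝ)) = RingHom.id ℝ := by
      ext; simp
    simp only [hring, Polynomial.coe_evalRingHom, Polynomial.eval_add, Polynomial.eval_mul,
      Polynomial.eval_C, Polynomial.eval_X, mul_comm (v _)] at this
    exact this
  rw [← heval, Polynomial.eval_eq_sum_range' hdeg]
  simp [Finset.sum_range_succ]

section Line

variable {E : Type*} [NormedAddCommGroup E] [NormedSpace ℝ E]

/-- The first two derivatives along a line, read off from a cubic expansion. -/
theorem fderiv_eq_of_eventually_eq_cubic {h : E → ℝ} (hc : ContDiff ℝ 2 h) {q w : E}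
    {a b c d : ℝ} (he : ∀ᶠ s in nhds (0 : ℝ), h (q + s • w) = a + b * s + c * s ^ 2 + d * s ^ 3) :
    fderiv ℝ h q w = b ∧ fderiv ℝ (fderiv ℝ h) q w w = 2 * c := by
  have hline (s : ℝ) : HasDerivAt (fun s : ℝ => q + s • w) w s := by
    simpa using ((hasDerivAt_id s).smul_const w).const_add q
  have hfirst (s : ℝ) : HasDerivAt (fun s : ℝ => h (q + s • w)) (fderiv ℝ h (q + s • w) w) s :=
    ((hc.differentiable (by norm_num)) _).hasFDerivAt.comp_hasDerivAt s (hline s)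
  have hpoly (s : ℝ) : HasDerivAt (fun s : ℝ => a + b * s + c * s ^ 2 + d * s ^ 3)
      (b + 2 * c * s + 3 * d * s ^ 2) s := by
    have := ((((hasDerivAt_id s).const_mul b).const_add a).add
      (((hasDerivAt_id s).pow 2).const_mul c)).add (((hasDerivAt_id s).pow 3).const_mul d)
    refine this.congr_deriv ?_
    simp; ring
  have hderiv : ∀ᶠ s in nhds (0 : ℝ),
      fderiv ℝ h (q + s • w) w = b + 2 * c * s + 3 * d * s ^ 2 := by
    filter_upwards [he.eventually_nhds] with s hs
    exact (hfirst s).unique ((hpoly s).congr_of_eventuallyEq hs)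
  have hdiff : Differentiable ℝ (fderiv ℝ h) :=
    (hc.fderiv_right (m := 1) (by norm_num)).differentiable (by norm_num)
  have hsecond : HasDerivAt (fun s : ℝ => fderiv ℝ h (q + s • w) w)
      (fderiv ℝ (fderiv ℝ h) (q + (0 : ℝ) • w) w w) 0 :=
    (((hdiff _).hasFDerivAt.comp_hasDerivAt (0 : ℝ) (hline 0)).clm_apply
      (hasDerivAt_const (0 : ℝ) w)).congr_deriv (by simp)
  have hquad : HasDerivAt (fun s : ℝ => b + 2 * c * s + 3 * d * s ^ 2) (2 * c) 0 := by
    have := (((hasDerivAt_id (0 : ℝ)).const_mul (2 * c)).const_add b).add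
      (((hasDerivAt_id (0 : ℝ)).pow 2).const_mul (3 * d))
    exact this.congr_deriv (by simp)
  refine ⟨by simpa using hderiv.self_of_nhds, ?_⟩
  simpa using hsecond.unique (hquad.congr_of_eventuallyEq hderiv)

theorem fderiv_self_of_homogeneous_cubic {h : E → ℝ} (hc : ContDiff ℝ 2 h)
    (hhom : ∀ (r : ℝ) x, h (r • x) = r ^ 3 * h x) (p : E) : fderiv ℝ h p p = 3 * h p := by
  refine (fderiv_eq_of_eventually_eq_cubic hc (a := h p) (c := 3 * h p) (d := h p)
    (Filter.Eventually.of_forall fun s => ?_)).1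
  rw [show p + s • p = (1 + s) • p by module, hhom]
  ring

/-- A segment in `{h > 0}` starting on `{h = 1}` projects radially into one component. -/
theorem exists_smul_mem_connectedComponentIn {h : E → ℝ} (hcont : Continuous h)
    (hhom : ∀ (r : ℝ) x, h (r • x) = r ^ 3 * h x) {p v : E} (hp : h p = 1)
    (hpos : ∀ u ∈ Icc (0 : ℝ) 1, 0 < h (p + u • v)) :
    ∃ r : ℝ, 0 < r ∧ r • (p + v) ∈ connectedComponentIn {x | h x = 1} p := by
  let r : ℝ → ℝ := fun u => h (p + u • v) ^ (-(1 / 3) : ℝ)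
  have hr : ∀ u ∈ Icc (0 : ℝ) 1, r u ^ 3 * h (p + u • v) = 1 := fun u hu => by
    simp only [r]
    rw [← Real.rpow_natCast, ← Real.rpow_mul (hpos u hu).le]
    norm_num
    rw [Real.rpow_neg_one, inv_mul_cancel₀ (hpos u hu).ne']
  have hγ : ContinuousOn (fun u => r u • (p + u • v)) (Icc 0 1) := by
    refine ContinuousOn.smul (ContinuousOn.rpow_const (by fun_prop) ?_) (by fun_prop)
    exact fun u hu => Or.inl (hpos u hu).ne'
  have hsub := (isPreconnected_Icc.image _ hγ).subset_connectedComponentIn (x := p)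
    (F := {x | h x = 1})
    ⟨0, by simp, by simp [r, hp]⟩ (by
      rintro _ ⟨u, hu, rfl⟩
      exact (hhom _ _).trans (hr u hu))
  refine ⟨r 1, Real.rpow_pos_of_pos (hpos 1 (by simp)) _, ?_⟩
  simpa using hsub ⟨1, by simp, rfl⟩

/-- The Hessian discriminant `A + B t - A² t²` of the binary cubic form `x³ + 3 A x y² + B y³`
at `(1, t)` vanishes for some `t` with `B t ≥ 0`. -/
theorem exists_root_same_sign {A : ℝ} (hA : 0 < A) (B : ℝ) :
    ∃ t : ℝ, 0 ≤ B * t ∧ A + B * t = A ^ 2 * t ^ 2 := by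
  have hD : 0 ≤ B ^ 2 + 4 * A ^ 3 := by positivity
  have hS := Real.sq_sqrt hD
  have hS0 := Real.sqrt_nonneg (B ^ 2 + 4 * A ^ 3)
  set S := Real.sqrt (B ^ 2 + 4 * A ^ 3)
  rcases le_total 0 B with hB | hB
  · refine ⟨(B + S) / (2 * A ^ 2), by positivity, ?_⟩
    field_simp
    linear_combination -hS
  · refine ⟨(B - S) / (2 * A ^ 2), mul_nonneg_of_nonpos_of_nonpos hB
      (div_nonpos_of_nonpos_of_nonneg (by linarith) (by positivity)), ?_⟩
    field_simp
    linear_combination -hS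

/-- If the Hessian is positive in some tangent direction `v` at `p`, then the component of `p`
contains a point at which it has a nonzero isotropic tangent vector. -/
theorem exists_isotropic_tangent_of_pos {h : E → ℝ} (hc : ContDiff ℝ 2 h)
    (hhom : ∀ (r : ℝ) x, h (r • x) = r ^ 3 * h x) {p v : E} (hp : h p = 1) (hv : v ≠ 0)
    (htan : fderiv ℝ h p v = 0) (hpos : 0 < fderiv ℝ (fderiv ℝ h) p v v)
    (hcubic : ∃ a b c d : ℝ, ∀ t : ℝ, h (p + t • v) = a + b * t + c * t ^ 2 + d * t ^ 3) :
    ∃ q ∈ connectedComponentIn {x | h x = 1} p, ∃ w ≠ 0,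
      fderiv ℝ h q w = 0 ∧ fderiv ℝ (fderiv ℝ h) q w w = 0 := by
  obtain ⟨a, b, c, B, hline⟩ := hcubic
  obtain ⟨hb, hc2⟩ := fderiv_eq_of_eventually_eq_cubic hc (Filter.Eventually.of_forall hline)
  have ha : a = 1 := by simpa [hp] using (hline 0).symm
  obtain rfl : b = 0 := hb.symm.trans htan
  subst ha
  obtain ⟨A, rfl⟩ : ∃ A, c = 3 * A := ⟨c / 3, by ring⟩
  have hA : 0 < A := by linarith
  obtain ⟨t, hBt, ht⟩ := exists_root_same_sign hA B
  have hseg : ∀ u ∈ Icc (0 : ℝ) 1, 0 < h (p + u • t • v) := fun u hu => by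
    rw [smul_smul, hline]
    have h0 := hu.1
    have : 0 ≤ 3 * A * (u * t) ^ 2 + u * (B * t) * (u * t) ^ 2 := by positivity
    linear_combination this
  obtain ⟨r, hr, hmem⟩ := exists_smul_mem_connectedComponentIn hc.continuous hhom hp hseg
  have hN : 0 < h (p + t • v) := by simpa using hseg 1 (by simp)
  rw [hline] at hN
  let N := 1 + 0 * t + 3 * A * t ^ 2 + B * t ^ 3
  let M := 2 * A * t + B * t ^ 2
  let w := N • v - M • (p + t • v)
  have hNpos : 0 < N := hN
  have hw : w ≠ 0 := fun hw => by
    have hD := congrArg (fderiv ℝ h p) hw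
    simp only [w, map_sub, map_add, map_smul, htan, map_zero,
      fderiv_self_of_homogeneous_cubic hc hhom, hp, smul_eq_mul] at hD
    have hM : M = 0 := by linarith
    simp only [w, hM, zero_smul, sub_zero] at hw
    exact (smul_ne_zero hNpos.ne' hv) hw
  have hexp : ∀ᶠ s in nhds (0 : ℝ), h (r • (p + t • v) + s • r • w) =
      r ^ 3 * N + 0 * s + 0 * s ^ 2 +
        r ^ 3 * (-N * M ^ 3 + 3 * M ^ 3 * N - 3 * (A + B * t) * M * N ^ 2 + B * N ^ 3) * s ^ 3 := by
    have hne : ∀ᶠ s in nhds (0 : ℝ), 1 - s * M ≠ 0 :=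
      (show ContinuousAt (fun s : ℝ => 1 - s * M) 0 by fun_prop).eventually_ne (by simp)
    filter_upwards [hne] with s hs
    have hpt : r • (p + t • v) + s • r • w =
        (r * (1 - s * M)) • (p + (t + s * N / (1 - s * M)) • v) := by
      simp only [w]
      match_scalars
      · ring
      · field_simp
        ring
    rw [hpt, hhom, hline]
    have hdisc : N * (A + B * t) = M ^ 2 := by
      simp only [N, M]
      linear_combination ht
    have hexpand : (1 - s * M) ^ 3 * (1 + 0 * (t + s * N / (1 - s * M)) +
        3 * A * (t + s * N / (1 - s * M)) ^ 2 + B * (t + s * N / (1 - s * M)) ^ 3) =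
        N * (1 - s * M) ^ 3 + 3 * M * (1 - s * M) ^ 2 * (s * N) +
          3 * (A + B * t) * (1 - s * M) * (s * N) ^ 2 + B * (s * N) ^ 3 := by
      generalize hz : s * N / (1 - s * M) = z
      have hz' : s * N = z * (1 - s * M) := by rw [← hz]; field_simp
      rw [hz']
      generalize 1 - s * M = y
      simp only [N, M]
      ring
    rw [mul_pow, mul_assoc, hexpand]
    linear_combination 3 * r ^ 3 * N * s ^ 2 * hdisc
  obtain ⟨h1, h2⟩ := fderiv_eq_of_eventually_eq_cubic hc hexp
  exact ⟨_, hmem, r • w, smul_ne_zero hr.ne' hw, h1, by simpa using h2⟩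

end Line

/-- A locally strictly convex connected component of the level set
`{h = 1}` of a homogeneous cubic polynomial `h` on `ℝ^{n+1}` (`n ≥ 1`) is
automatically hyperbolic: if the Hessian `D²h_p` is definite on `ker Dh_p` at
every point `p`, then it is in fact negative definite at every point (i.e. the
centroaffine metric `−(1/3)·D²h` is positive definite on tangent spaces). -/
theorem stmt_14 (n : ℕ) (hn : 1 ≤ n)
    (P : MvPolynomial (Fin (n + 1)) ℝ) (hP : P.IsHomogeneous 3)
    (h : EuclideanSpace ℝ (Fin (n + 1)) → ℝ)
    (hh : ∀ x, h x = MvPolynomial.eval (fun i => x i) P)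
    (H : Set (EuclideanSpace ℝ (Fin (n + 1))))
    (x₀ : EuclideanSpace ℝ (Fin (n + 1))) (hx₀ : h x₀ = 1)
    (hH : H = connectedComponentIn {x | h x = 1} x₀)
    (hdefinite : ∀ p ∈ H,
      (∀ v : EuclideanSpace ℝ (Fin (n + 1)),
        fderiv ℝ h p v = 0 → v ≠ 0 → 0 < fderiv ℝ (fderiv ℝ h) p v v) ∨
      (∀ v : EuclideanSpace ℝ (Fin (n + 1)),
        fderiv ℝ h p v = 0 → v ≠ 0 → fderiv ℝ (fderiv ℝ h) p v v < 0)) :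
    ∀ p ∈ H, ∀ v : EuclideanSpace ℝ (Fin (n + 1)),
      fderiv ℝ h p v = 0 → v ≠ 0 → fderiv ℝ (fderiv ℝ h) p v v < 0 := by
  have hc : ContDiff ℝ 2 h := funext hh ▸ contDiff_eval_coord P
  subst hH
  intro p hp v htan hv
  refine (hdefinite p hp).elim (fun hpd => ?_) fun hnd => hnd v htan hv
  have hhom (r : ℝ) (x : EuclideanSpace ℝ (Fin (n + 1))) : h (r • x) = r ^ 3 * h x := by
    simpa [hh] using hP.eval_mul_left r (fun i => x i)
  have hp1 : p ∈ {x | h x = 1} := connectedComponentIn_subset _ _ hp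
  obtain ⟨q, hq, w, hw, h1, h2⟩ := exists_isotropic_tangent_of_pos hc hhom
    hp1 hv htan (hpd v htan hv)
    (by simpa [hh] using hP.exists_eval_line_eq (fun i => p i) (fun i => v i))
  rw [← connectedComponentIn_eq hp] at hq
  rcases hdefinite q hq with hd | hd
  · exact absurd h2 (hd w h1 hw).ne'
  · exact absurd h2 (hd w h1 hw).ne
end

section
/- Let k > 1 and define h : U := {(x, y) ∈ ℝ² : x > 0, y > 0} → ℝ by h(x, y) = (x·y/(x + y))^k, and let H := {(x, y) ∈ U : h(x, y) = 1}. Then: h is smooth, positive, and positively homogeneous of degree k on U; H is a nonempty closed subset of ℝ²; D²h_p is negative definite on ker Dh_p for every p ∈ H; and there exists a smooth curve γ : [0, 1) → H not contained in any compact subset of H whose centroaffine length ∫₀¹ √(−(1/k)·D²h_{γ(t)}(γ'(t), γ'(t))) dt is finite. In particular, H is a Euclidean complete hyperbolic centroaffine curve that is incomplete with respect to the centroaffine metric. -/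
open Set MeasureTheory ENNReal

/-- The function `(x, y) ↦ (xy / (x + y)) ^ k` on the plane. -/
noncomputable def parallelSumRpow (k : ℝ) (p : EuclideanSpace ℝ (Fin 2)) : ℝ :=
  ((p 0 * p 1) / (p 0 + p 1)) ^ k

theorem contDiffAt_parallelSumRpow (k : ℝ) {n : WithTop ℕ∞} {p : EuclideanSpace ℝ (Fin 2)}
    (h0 : 0 < p 0) (h1 : 0 < p 1) : ContDiffAt ℝ n (parallelSumRpow k) p := by
  have e0 : ContDiffAt ℝ n (fun q : EuclideanSpace ℝ (Fin 2) => q 0) p := by fun_prop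
  have e1 : ContDiffAt ℝ n (fun q : EuclideanSpace ℝ (Fin 2) => q 1) p := by fun_prop
  exact ((e0.mul e1).div (e0.add e1) (add_pos h0 h1).ne').rpow_const_of_ne
    (div_pos (mul_pos h0 h1) (add_pos h0 h1)).ne'

theorem isOpen_quadrant : IsOpen {p : EuclideanSpace ℝ (Fin 2) | 0 < p 0 ∧ 0 < p 1} :=
  IsOpen.inter (s := {p : EuclideanSpace ℝ (Fin 2) | 0 < p 0})
    (t := {p : EuclideanSpace ℝ (Fin 2) | 0 < p 1})
    (isOpen_lt continuous_const (by fun_prop)) (isOpen_lt continuous_const (by fun_prop))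

theorem hasDerivAt_line {E : Type*} [NormedAddCommGroup E] [NormedSpace ℝ E] (p v : E) (t : ℝ) :
    HasDerivAt (fun t : ℝ => p + t • v) v t := by
  simpa using ((hasDerivAt_id t).smul_const v).const_add p

theorem fderiv_parallelSumRpow (k : ℝ) {p : EuclideanSpace ℝ (Fin 2)}
    (h0 : 0 < p 0) (h1 : 0 < p 1) (v : EuclideanSpace ℝ (Fin 2)) :
    fderiv ℝ (parallelSumRpow k) p v =
      k * ((p 0 * p 1) / (p 0 + p 1)) ^ (k - 1) *
        ((p 1 ^ 2 * v 0 + p 0 ^ 2 * v 1) / (p 0 + p 1) ^ 2) := by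
  have hd : HasFDerivAt (parallelSumRpow k) (fderiv ℝ (parallelSumRpow k) p) (p + (0 : ℝ) • v) := by
    simpa using ((contDiffAt_parallelSumRpow k (n := 1) h0 h1).differentiableAt
      (by simp)).hasFDerivAt
  have key := hd.comp_hasDerivAt (0 : ℝ) (hasDerivAt_line p v 0)
  have c (i : Fin 2) : HasDerivAt (fun t : ℝ => p i + t * v i) (v i) 0 := by
    simpa using ((hasDerivAt_id (0 : ℝ)).mul_const (v i)).const_add (p i)
  have hs : p 0 + p 1 ≠ 0 := by positivity
  have key2 := (((c 0).mul (c 1)).div ((c 0).add (c 1)) (by simpa using hs)).rpow_const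
    (p := k) (Or.inl (by simp; exact ⟨⟨h0.ne', h1.ne'⟩, hs⟩))
  refine (key.unique (key2.congr_of_eventuallyEq (.of_forall fun t => ?_))).trans ?_
  · simp [parallelSumRpow]
  · simp
    field_simp
    ring

theorem hasDerivAt_fderiv_apply_line {E : Type*} [NormedAddCommGroup E] [NormedSpace ℝ E]
    {f : E → ℝ} {p : E} (hf : DifferentiableAt ℝ (fderiv ℝ f) p) (v : E) :
    HasDerivAt (fun t : ℝ => fderiv ℝ f (p + t • v) v) (fderiv ℝ (fderiv ℝ f) p v v) 0 := by
  have hd : HasFDerivAt (fderiv ℝ f) (fderiv ℝ (fderiv ℝ f) p) (p + (0 : ℝ) • v) := by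
    simpa using hf.hasFDerivAt
  exact (ContinuousLinearMap.apply ℝ ℝ v).hasFDerivAt.comp_hasDerivAt (0 : ℝ)
    (hd.comp_hasDerivAt (0 : ℝ) (hasDerivAt_line p v 0))

theorem hasDerivAt_parallelSumRpow_gradient_line (k : ℝ) {a b : ℝ} (ha : 0 < a) (hb : 0 < b)
    (h : a * b / (a + b) = 1) (v w : ℝ) :
    HasDerivAt (fun t : ℝ => k * ((a + t * v) * (b + t * w) / (a + t * v + (b + t * w))) ^ (k - 1) *
        (((b + t * w) ^ 2 * v + (a + t * v) ^ 2 * w) / (a + t * v + (b + t * w)) ^ 2))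
      (k * (k - 1) * ((b ^ 2 * v + a ^ 2 * w) / (a + b) ^ 2) ^ 2 -
        2 * k * (b * v - a * w) ^ 2 / (a + b) ^ 3) 0 := by
  have c (x y : ℝ) : HasDerivAt (fun t : ℝ => x + t * y) y 0 := by
    simpa using ((hasDerivAt_id (0 : ℝ)).mul_const y).const_add x
  have hs : a + b ≠ 0 := by positivity
  have base : HasDerivAt (fun t : ℝ => (a + t * v) * (b + t * w) / (a + t * v + (b + t * w)))
      ((b ^ 2 * v + a ^ 2 * w) / (a + b) ^ 2) 0 := by
    refine (((c a v).fun_mul (c b w)).fun_div ((c a v).fun_add (c b w))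
      (by simpa using hs)).congr_deriv ?_
    simp
    field_simp
    ring
  have pow := (base.rpow_const (p := k - 1) (Or.inl (by simp [h]))).const_mul k
  have grad := ((((c b w).fun_pow 2).mul_const v).fun_add
    (((c a v).fun_pow 2).mul_const w)).fun_div
      (((c a v).fun_add (c b w)).fun_pow 2) (by simpa using hs)
  refine (pow.fun_mul grad).congr_deriv ?_
  simp [h]
  field_simp
  ring

theorem fderiv_fderiv_parallelSumRpow (k : ℝ) {p : EuclideanSpace ℝ (Fin 2)}
    (h0 : 0 < p 0) (h1 : 0 < p 1) (h : (p 0 * p 1) / (p 0 + p 1) = 1)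
    (v : EuclideanSpace ℝ (Fin 2)) :
    fderiv ℝ (fderiv ℝ (parallelSumRpow k)) p v v =
      k * (k - 1) * ((p 1 ^ 2 * v 0 + p 0 ^ 2 * v 1) / (p 0 + p 1) ^ 2) ^ 2 -
        2 * k * (p 1 * v 0 - p 0 * v 1) ^ 2 / (p 0 + p 1) ^ 3 := by
  have line := hasDerivAt_fderiv_apply_line (((contDiffAt_parallelSumRpow k (n := 2) h0 h1
    ).fderiv_right (m := 1) (by norm_num [one_add_one_eq_two])).differentiableAt (by simp)) v
  have hev : ∀ᶠ t : ℝ in nhds 0, p + t • v ∈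
      {p : EuclideanSpace ℝ (Fin 2) | 0 < p 0 ∧ 0 < p 1} :=
    (hasDerivAt_line p v 0).continuousAt.eventually_mem
      (isOpen_quadrant.mem_nhds (by simpa using ⟨h0, h1⟩))
  refine line.unique ((hasDerivAt_parallelSumRpow_gradient_line k h0 h1 h (v 0) (v 1)
    ).congr_of_eventuallyEq (hev.mono fun t ht => ?_))
  simpa using fderiv_parallelSumRpow k ht.1 ht.2 v

/-- A parametrization of the branch `x ≤ 2` of the curve `xy = x + y` in the open quadrant,
escaping to infinity as `t` tends to `1`. -/
noncomputable def escapingCurve (t : ℝ) : EuclideanSpace ℝ (Fin 2) :=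
  !₂[1 + (1 - t) ^ 2, 1 + ((1 - t) ^ 2)⁻¹]

theorem hasDerivAt_escapingCurve {t : ℝ} (ht : t < 1) :
    HasDerivAt escapingCurve !₂[-2 * (1 - t), 2 / (1 - t) ^ 3] t := by
  have hu : (1 - t) ≠ 0 := by linarith
  have e : HasDerivAt (fun t : ℝ => (1 - t) ^ 2) (-2 * (1 - t)) t := by
    refine (((hasDerivAt_id t).const_sub 1).fun_pow 2).congr_deriv ?_
    simp
  rw [hasDerivAt_iff_hasFDerivAt, ← hasFDerivWithinAt_univ, hasFDerivWithinAt_euclidean]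
  intro i
  rw [hasFDerivWithinAt_univ, hasFDerivAt_iff_hasDerivAt]
  fin_cases i
  · simpa [escapingCurve] using e
  · refine ((e.fun_inv (pow_ne_zero 2 hu)).const_add 1).congr_deriv ?_
    simp
    field_simp

theorem contDiffOn_escapingCurve {n : WithTop ℕ∞} :
    ContDiffOn ℝ n escapingCurve (Ico (0 : ℝ) 1) := by
  rw [contDiffOn_euclidean]
  intro i
  have e : ContDiffOn ℝ n (fun t : ℝ => (1 - t) ^ 2) (Ico (0 : ℝ) 1) := by fun_prop
  fin_cases i
  · simpa [escapingCurve] using contDiffOn_const.add e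
  · exact contDiffOn_const.add (e.inv fun t ht => pow_ne_zero 2 (by linarith [ht.2]))

/-- counterexample: For `k > 1` the function
`h(x,y) = (xy/(x+y))^k` on the quadrant `U = {x > 0, y > 0} ⊆ ℝ²` is smooth,
positive and positively homogeneous of degree `k`; its level set `H = {h = 1}` is
a nonempty closed (hence Euclidean complete) hyperbolic centroaffine curve, but
there is a smooth curve `γ : [0,1) → H` escaping every compact subset of `H`
with finite centroaffine length — so `H` is incomplete for the centroaffine
metric. -/
theorem stmt_15 (k : ℝ) (hk : 1 < k)
    (U : Set (EuclideanSpace ℝ (Fin 2)))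
    (hUdef : U = {p : EuclideanSpace ℝ (Fin 2) | 0 < p 0 ∧ 0 < p 1})
    (h : EuclideanSpace ℝ (Fin 2) → ℝ)
    (hhdef : ∀ p : EuclideanSpace ℝ (Fin 2), h p = ((p 0 * p 1) / (p 0 + p 1)) ^ k)
    (H : Set (EuclideanSpace ℝ (Fin 2)))
    (hHdef : H = {p ∈ U | h p = 1}) :
    ContDiffOn ℝ ⊤ h U ∧
    (∀ p ∈ U, 0 < h p) ∧
    (∀ l : ℝ, 0 < l → ∀ p ∈ U, h (l • p) = l ^ k * h p) ∧
    H.Nonempty ∧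
    IsClosed H ∧
    (∀ p ∈ H, ∀ v : EuclideanSpace ℝ (Fin 2),
      fderiv ℝ h p v = 0 → v ≠ 0 → fderiv ℝ (fderiv ℝ h) p v v < 0) ∧
    ∃ γ : ℝ → EuclideanSpace ℝ (Fin 2),
      ContDiffOn ℝ (⊤ : ℕ∞) γ (Ico (0 : ℝ) 1) ∧
      (∀ t ∈ Ico (0 : ℝ) 1, γ t ∈ H) ∧
      (¬ ∃ K : Set (EuclideanSpace ℝ (Fin 2)), IsCompact K ∧ K ⊆ H ∧
        γ '' Ico (0 : ℝ) 1 ⊆ K) ∧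
      ∫⁻ t in Ico (0 : ℝ) 1,
        ENNReal.ofReal (Real.sqrt (-(1 / k) *
          fderiv ℝ (fderiv ℝ h) (γ t)
            (derivWithin γ (Ico (0 : ℝ) 1) t)
            (derivWithin γ (Ico (0 : ℝ) 1) t))) ≠ ⊤ := by
  obtain rfl : h = parallelSumRpow k := funext hhdef
  have hU (p) : p ∈ U ↔ 0 < p 0 ∧ 0 < p 1 := by rw [hUdef]; rfl
  have hH (p) : p ∈ H ↔ (0 < p 0 ∧ 0 < p 1) ∧ p 0 * p 1 / (p 0 + p 1) = 1 := by
    rw [hHdef, mem_sep_iff, hU]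
    refine and_congr_right fun ⟨h0, h1⟩ => ?_
    rw [hhdef, ← Real.one_rpow k]
    exact (Real.rpow_left_inj (by positivity) zero_le_one (by linarith)).trans (by simp)
  have hH' : H = {p | 1 ≤ p 0} ∩ ({p | 1 ≤ p 1} ∩ {p | p 0 * p 1 = p 0 + p 1}) := by
    ext p
    rw [hH]
    constructor
    · rintro ⟨⟨h0, h1⟩, h2⟩
      rw [div_eq_one_iff_eq (by positivity)] at h2
      exact ⟨show 1 ≤ p 0 by nlinarith, show 1 ≤ p 1 by nlinarith, h2⟩
    · rintro ⟨h0 : 1 ≤ p 0, h1 : 1 ≤ p 1, h2 : p 0 * p 1 = p 0 + p 1⟩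
      exact ⟨⟨by linarith, by linarith⟩, (div_eq_one_iff_eq (by linarith)).2 h2⟩
  have hγ : ∀ t ∈ Ico (0 : ℝ) 1, escapingCurve t ∈ H := by
    intro t ht
    have hu : 0 < 1 - t := by linarith [ht.2]
    rw [hH]
    simp only [escapingCurve, PiLp.toLp_apply, Matrix.cons_val_zero, Matrix.cons_val_one]
    refine ⟨⟨by positivity, by positivity⟩, ?_⟩
    field_simp
    ring
  refine ⟨?_, ?_, ?_, ⟨_, hγ 0 (by simp)⟩, ?_, ?_, escapingCurve, contDiffOn_escapingCurve, hγ,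
    ?_, ?_⟩
  · intro p hp
    exact (contDiffAt_parallelSumRpow k ((hU p).1 hp).1 ((hU p).1 hp).2).contDiffWithinAt
  · intro p hp
    obtain ⟨h0, h1⟩ := (hU p).1 hp
    exact Real.rpow_pos_of_pos (by positivity) k
  · intro l hl p hp
    obtain ⟨h0, h1⟩ := (hU p).1 hp
    rw [parallelSumRpow, parallelSumRpow, ← Real.mul_rpow hl.le (by positivity)]
    congr 1
    simp
    field_simp
  · rw [hH']
    exact (isClosed_le continuous_const (by fun_prop)).inter
      ((isClosed_le continuous_const (by fun_prop)).inter
        (isClosed_eq (by fun_prop) (by fun_prop)))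
  · intro p hp v hv hv0
    obtain ⟨⟨h0, h1⟩, h2⟩ := (hH p).1 hp
    have hs : 0 < p 0 + p 1 := by positivity
    rw [fderiv_parallelSumRpow k h0 h1, h2, Real.one_rpow] at hv
    have hz : (p 1 ^ 2 * v 0 + p 0 ^ 2 * v 1) / (p 0 + p 1) ^ 2 = 0 := by
      simpa [(by linarith : k ≠ 0)] using hv
    rw [fderiv_fderiv_parallelSumRpow k h0 h1 h2, hz]
    have hw : p 1 * v 0 - p 0 * v 1 ≠ 0 := by
      intro hw
      apply hv0
      have hz' : p 1 ^ 2 * v 0 + p 0 ^ 2 * v 1 = 0 := by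
        simpa [hs.ne'] using hz
      have a0 : v 0 * (p 1 * (p 0 + p 1)) = 0 := by linear_combination hz' + p 0 * hw
      have a1 : v 1 * (p 0 * (p 0 + p 1)) = 0 := by linear_combination hz' - p 1 * hw
      ext i
      fin_cases i
      · simpa [h1.ne', hs.ne'] using a0
      · simpa [h0.ne', hs.ne'] using a1
    have : 0 < 2 * k * (p 1 * v 0 - p 0 * v 1) ^ 2 / (p 0 + p 1) ^ 3 := by positivity
    linarith
  · rintro ⟨K, hK, -, hsub⟩
    obtain ⟨C, hC⟩ := hK.isBounded.exists_norm_le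
    set M := max C 1
    have hM : 1 ≤ M := le_max_right _ _
    have hM0 : 0 < M := by linarith
    have ht : 1 - M⁻¹ ∈ Ico (0 : ℝ) 1 :=
      ⟨by linarith [inv_le_one_of_one_le₀ hM], by linarith [inv_pos.2 hM0]⟩
    have hle := (PiLp.norm_apply_le (escapingCurve (1 - M⁻¹)) 1).trans
      (hC _ (hsub (mem_image_of_mem _ ht)))
    have he : escapingCurve (1 - M⁻¹) 1 = 1 + M ^ 2 := by simp [escapingCurve]
    rw [he, Real.norm_of_nonneg (by positivity)] at hle
    nlinarith [le_max_left C 1]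
  · refine ne_top_of_le_ne_top (b := ∫⁻ _ in Ico (0 : ℝ) 1, ENNReal.ofReal 3) (by simp)
      (setLIntegral_mono measurable_const fun t ht => ENNReal.ofReal_le_ofReal ?_)
    obtain ⟨⟨h0, h1⟩, h2⟩ := (hH _).1 (hγ t ht)
    have hu : 0 < 1 - t := by linarith [ht.2]
    rw [(hasDerivAt_escapingCurve ht.2).hasDerivWithinAt.derivWithin
      (uniqueDiffOn_Ico 0 1 t ht), fderiv_fderiv_parallelSumRpow k h0 h1 h2]
    rw [Real.sqrt_le_left (by norm_num)]
    simp only [escapingCurve, PiLp.toLp_apply, Matrix.cons_val_zero, Matrix.cons_val_one]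
    set u := 1 - t
    have hk0 : 0 < k := by linarith
    calc _ = 8 / (1 + u ^ 2) ^ 2 := by
          field_simp
          ring
      _ ≤ 8 := div_le_self (by norm_num) (one_le_pow₀ (by nlinarith))
      _ ≤ 3 ^ 2 := by norm_num
end

section
/- For a ≥ 0 define the polynomial η_a : ℝ → ℝ by η_a(x) := x·(1 − x)·((x − 3/20)² + 51/400 + a). Then: (1) η_a(0) = η_a(1) = 0 and η_a(x) > 0 for all x ∈ (0, 1) and all a ≥ 0; (2) for every a > 0 and every x ∈ [0, 1], (3/4)·(η_a'(x))² − η_a(x)·η_a''(x) > 0. -/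
open Set

/-- For `a ≥ 0` let `η_a(x) = x(1−x)((x − 3/20)² + 51/400 + a)`.
Then (1) `η_a(0) = η_a(1) = 0` and `η_a > 0` on `(0,1)` for all `a ≥ 0`;
(2) for every `a > 0`, `(3/4)·(η_a')² − η_a·η_a'' > 0` on `[0,1]`. -/
theorem stmt_16
    (η : ℝ → ℝ → ℝ)
    (hη : ∀ a x : ℝ, η a x = x * (1 - x) * ((x - 3 / 20) ^ 2 + 51 / 400 + a)) :
    (∀ a : ℝ, 0 ≤ a →
      η a 0 = 0 ∧ η a 1 = 0 ∧ ∀ x ∈ Ioo (0 : ℝ) 1, 0 < η a x) ∧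
    (∀ a : ℝ, 0 < a → ∀ x ∈ Icc (0 : ℝ) 1,
      0 < 3 / 4 * (deriv (η a) x) ^ 2 - η a x * deriv (deriv (η a)) x) := by
  refine ⟨fun a ha => ⟨by simp [hη], by simp [hη], ?_⟩, fun a ha x hx => ?_⟩
  · rintro x ⟨h0, h1⟩
    rw [hη]
    have h1' : 0 < 1 - x := by linarith
    positivity
  · have d1 : deriv (η a) = fun y =>
        -4 * y ^ 3 + 39 / 10 * y ^ 2 - 2 * (a + 9 / 20) * y + (a + 3 / 20) := by
      funext y
      have h : HasDerivAt (fun y : ℝ => y * (1 - y) * ((y - 3 / 20) ^ 2 + 51 / 400 + a)) _ y :=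
        ((hasDerivAt_id' y).mul ((hasDerivAt_id' y).const_sub 1)).mul
          (((((hasDerivAt_id' y).sub_const (3 / 20)).pow 2).add_const (51 / 400)).add_const a)
      rw [show η a = _ from funext (hη a), h.deriv]
      push_cast
      simp only [Pi.mul_apply]
      ring
    have d2 : deriv (deriv (η a)) x = -12 * x ^ 2 + 39 / 5 * x - 2 * (a + 9 / 20) := by
      rw [d1]
      have h : HasDerivAt (fun y : ℝ =>
          -4 * y ^ 3 + 39 / 10 * y ^ 2 - 2 * (a + 9 / 20) * y + (a + 3 / 20)) _ x :=
        (((((hasDerivAt_id' x).pow 3).const_mul (-4)).add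
          (((hasDerivAt_id' x).pow 2).const_mul (39 / 10))).sub
          ((hasDerivAt_id' x).const_mul (2 * (a + 9 / 20)))).add_const (a + 3 / 20)
      rw [h.deriv]
      push_cast
      ring
    rw [d2, d1, hη]
    obtain ⟨h0, h1⟩ := hx
    have hL : 0 < -2 * x ^ 4 + 47 / 10 * x ^ 3 - 21 / 20 * x ^ 2 - 3 / 5 * x + 9 / 40 := by
      have e1 := mul_nonneg (mul_nonneg h0 (sub_nonneg.2 h1)) (sq_nonneg (x - 2 / 5))
      have e2 := mul_nonneg h0 (sq_nonneg (x - 33 / 100))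
      nlinarith [sq_nonneg (x - 326 / 1000)]
    have hQ : 0 < x ^ 2 - x + 3 / 4 := by nlinarith [sq_nonneg (x - 1 / 2)]
    have key : 0 < 3 / 400 * (7 * x ^ 2 + 3 * x - 3 / 2) ^ 2 +
        a * (-2 * x ^ 4 + 47 / 10 * x ^ 3 - 21 / 20 * x ^ 2 - 3 / 5 * x + 9 / 40) +
        a ^ 2 * (x ^ 2 - x + 3 / 4) := by
      positivity
    refine key.trans_eq ?_
    ring
end

section
/- For a ≥ 0 define η_a : ℝ → ℝ by η_a(x) := x·(1 − x)·((x − 3/20)² + 51/400 + a). Then for every constant c < 3/4 there exist a ∈ (0, 1] and x ∈ [0, 1] such that c·(η_a'(x))² < η_a(x)·η_a''(x). In other words, there is no constant c < 3/4 with c·(η_a'(x))² − η_a(x)·η_a''(x) ≥ 0 for all x ∈ [0, 1] and all sufficiently small a > 0. -/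
open Set

/-- The quadratic `7x² + 3x − 3/2`, whose square is a multiple of `(3/4)·(η_0')² − η_0·η_0''`,
has a root in `(0, 3/10)`. -/
lemma exists_root_quadratic :
    ∃ x ∈ Ioo (0 : ℝ) (3 / 10), 7 * x ^ 2 + 3 * x - 3 / 2 = 0 := by
  have hs : √(51 : ℝ) ^ 2 = 51 := Real.sq_sqrt (by norm_num)
  have h₁ : 3 < √(51 : ℝ) := Real.lt_sqrt_of_sq_lt (by norm_num)
  have h₂ : √(51 : ℝ) < 36 / 5 := (Real.sqrt_lt' (by norm_num)).2 (by norm_num)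
  refine ⟨(√51 - 3) / 14, ⟨by linarith, by linarith⟩, ?_⟩
  linear_combination hs / 28

lemma hasDerivAt_quartic (a x : ℝ) :
    HasDerivAt (fun x : ℝ => x * (1 - x) * ((x - 3 / 20) ^ 2 + 51 / 400 + a))
      (-4 * x ^ 3 + 39 / 10 * x ^ 2 - 9 / 10 * x + 3 / 20 + a * (1 - 2 * x)) x := by
  have hx := hasDerivAt_id' x
  refine ((hx.mul (hx.const_sub 1)).mul
    ((((hx.sub_const (3 / 20)).pow 2).add_const (51 / 400)).add_const a)).congr_deriv ?_
  simp only [Pi.mul_apply, Pi.pow_apply]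
  push_cast
  ring

lemma hasDerivAt_deriv_quartic (a x : ℝ) :
    HasDerivAt
      (fun x : ℝ => -4 * x ^ 3 + 39 / 10 * x ^ 2 - 9 / 10 * x + 3 / 20 + a * (1 - 2 * x))
      (-12 * x ^ 2 + 39 / 5 * x - 9 / 10 - 2 * a) x := by
  have hx := hasDerivAt_id' x
  refine ((((((hx.pow 3).const_mul (-4)).add ((hx.pow 2).const_mul (39 / 10))).sub
    (hx.const_mul (9 / 10))).add_const (3 / 20)).add
    (((hx.const_mul 2).const_sub 1).const_mul a)).congr_deriv ?_
  push_cast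
  ring

/-- For `η_a(x) = x(1−x)((x − 3/20)² + 51/400 + a)`, no constant
`c < 3/4` satisfies `c·(η_a')² − η_a·η_a'' ≥ 0` on `[0,1]` for all small `a > 0`:
for every `c < 3/4` there exist `a ∈ (0,1]` and `x ∈ [0,1]` with
`c·(η_a'(x))² < η_a(x)·η_a''(x)`. -/
theorem stmt_17
    (η : ℝ → ℝ → ℝ)
    (hη : ∀ a x : ℝ, η a x = x * (1 - x) * ((x - 3 / 20) ^ 2 + 51 / 400 + a)) :
    ∀ c : ℝ, c < 3 / 4 →
      ∃ a ∈ Ioc (0 : ℝ) 1, ∃ x ∈ Icc (0 : ℝ) 1,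
        c * (deriv (η a) x) ^ 2 < η a x * deriv (deriv (η a)) x := by
  intro c hc
  obtain ⟨x, ⟨hx0, hx1⟩, hx⟩ := exists_root_quadratic
  have hη_fun (a : ℝ) :
      η a = fun x => x * (1 - x) * ((x - 3 / 20) ^ 2 + 51 / 400 + a) := funext (hη a)
  have hderiv (a : ℝ) : deriv (η a) =
      fun x => -4 * x ^ 3 + 39 / 10 * x ^ 2 - 9 / 10 * x + 3 / 20 + a * (1 - 2 * x) := by
    rw [hη_fun]
    exact funext fun y => (hasDerivAt_quartic a y).deriv
  have hderiv₂ (a : ℝ) :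
      deriv (deriv (η a)) x = -12 * x ^ 2 + 39 / 5 * x - 9 / 10 - 2 * a := by
    rw [hderiv]
    exact (hasDerivAt_deriv_quartic a x).deriv
  set d := -4 * x ^ 3 + 39 / 10 * x ^ 2 - 9 / 10 * x + 3 / 20 with hd
  have hd_pos : 0 < d := by
    have : d = (663 / 10 - 204 * x) / 49 := by
      rw [hd]
      linear_combination (-4 / 7 * x + 393 / 490) * hx
    rw [this]
    linarith
  have hzero : c * (d + 0 * (1 - 2 * x)) ^ 2 <
      x * (1 - x) * ((x - 3 / 20) ^ 2 + 51 / 400 + 0) *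
        (-12 * x ^ 2 + 39 / 5 * x - 9 / 10 - 2 * 0) := by
    have hsq : x * (1 - x) * ((x - 3 / 20) ^ 2 + 51 / 400 + 0) *
        (-12 * x ^ 2 + 39 / 5 * x - 9 / 10 - 2 * 0) = 3 / 4 * d ^ 2 := by
      rw [hd]
      linear_combination (-3 / 400 * (7 * x ^ 2 + 3 * x - 3 / 2)) * hx
    rw [hsq, zero_mul, add_zero]
    exact mul_lt_mul_of_pos_right hc (by positivity)
  have hnear : ∀ᶠ a in nhds (0 : ℝ), c * (d + a * (1 - 2 * x)) ^ 2 <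
      x * (1 - x) * ((x - 3 / 20) ^ 2 + 51 / 400 + a) *
        (-12 * x ^ 2 + 39 / 5 * x - 9 / 10 - 2 * a) :=
    ContinuousAt.eventually_lt (by fun_prop) (by fun_prop) hzero
  obtain ⟨a, ha, ha'⟩ := ((hnear.filter_mono nhdsWithin_le_nhds).and
    (Ioc_mem_nhdsGT (zero_lt_one' ℝ))).exists
  refine ⟨a, ha', x, ⟨hx0.le, by linarith⟩, ?_⟩
  rw [hderiv₂, hderiv, hη]
  exact ha
end

section
/- Define η₀ : ℝ → ℝ by η₀(x) := x·(1 − x)·((x − 3/20)² + 51/400) = −x⁴ + (13/10)x³ − (9/20)x² + (3/20)x. Then: (1) for all x ∈ ℝ, (3/4)·(η₀'(x))² − η₀(x)·η₀''(x) = 3·(14x² + 6x − 3)²/1600; (2) x₀ := (√51 − 3)/14 lies in [0, 1] and is the unique zero of 14x² + 6x − 3 in [0, 1]; (3) η₀'(x₀) = −4x₀³ + (39/10)x₀² − (9/10)x₀ + 3/20 ≠ 0. Consequently (3/4)·(η₀'(x))² − η₀(x)·η₀''(x) is nonnegative on [0, 1] and vanishes there exactly at x₀, while η₀'(x₀) ≠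 0. -/
open Set

/-- For `η₀(x) = x(1−x)((x − 3/20)² + 51/400)
= −x⁴ + (13/10)x³ − (9/20)x² + (3/20)x`:
(1) `(3/4)(η₀')² − η₀·η₀'' = 3(14x² + 6x − 3)²/1600` for all `x`;
(2) `x₀ = (√51 − 3)/14` lies in `[0,1]` and is the unique zero of `14x² + 6x − 3`
in `[0,1]`;
(3) `η₀'(x₀) = −4x₀³ + (39/10)x₀² − (9/10)x₀ + 3/20 ≠ 0`.
Consequently `(3/4)(η₀')² − η₀·η₀''` is nonnegative on `[0,1]` and vanishes there
exactly at `x₀`, while `η₀'(x₀) ≠ 0`. -/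
theorem stmt_18
    (η₀ : ℝ → ℝ)
    (hη₀ : ∀ x : ℝ, η₀ x = x * (1 - x) * ((x - 3 / 20) ^ 2 + 51 / 400))
    (x₀ : ℝ) (hx₀ : x₀ = (Real.sqrt 51 - 3) / 14) :
    (∀ x : ℝ, η₀ x
      = -x ^ 4 + 13 / 10 * x ^ 3 - 9 / 20 * x ^ 2 + 3 / 20 * x) ∧
    (∀ x : ℝ, 3 / 4 * (deriv η₀ x) ^ 2 - η₀ x * deriv (deriv η₀) x
      = 3 * (14 * x ^ 2 + 6 * x - 3) ^ 2 / 1600) ∧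
    (x₀ ∈ Icc (0 : ℝ) 1 ∧
      ∀ x ∈ Icc (0 : ℝ) 1, 14 * x ^ 2 + 6 * x - 3 = 0 ↔ x = x₀) ∧
    (deriv η₀ x₀ = -4 * x₀ ^ 3 + 39 / 10 * x₀ ^ 2 - 9 / 10 * x₀ + 3 / 20 ∧
      deriv η₀ x₀ ≠ 0) ∧
    (∀ x ∈ Icc (0 : ℝ) 1,
      0 ≤ 3 / 4 * (deriv η₀ x) ^ 2 - η₀ x * deriv (deriv η₀) x ∧
      (3 / 4 * (deriv η₀ x) ^ 2 - η₀ x * deriv (deriv η₀) x = 0 ↔ x = x₀)) := by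
  have hpoly : ∀ x : ℝ, η₀ x
      = -x ^ 4 + 13 / 10 * x ^ 3 - 9 / 20 * x ^ 2 + 3 / 20 * x := fun x => by
    rw [hη₀]; ring
  have hderiv : deriv η₀ = fun x : ℝ =>
      -4 * x ^ 3 + 39 / 10 * x ^ 2 - 9 / 10 * x + 3 / 20 := by
    funext x
    rw [funext hpoly]
    have h := ((((hasDerivAt_pow 4 x).neg.add ((hasDerivAt_pow 3 x).const_mul (13 / 10 : ℝ))).sub
      ((hasDerivAt_pow 2 x).const_mul (9 / 20 : ℝ))).add
      ((hasDerivAt_id x).const_mul (3 / 20 : ℝ)))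
    refine (h.congr_deriv ?_).deriv
    norm_num
    ring
  have hderiv2 : deriv (deriv η₀) = fun x : ℝ =>
      -12 * x ^ 2 + 39 / 5 * x - 9 / 10 := by
    funext x
    rw [hderiv]
    have h := (((((hasDerivAt_pow 3 x).const_mul (-4 : ℝ)).add
      ((hasDerivAt_pow 2 x).const_mul (39 / 10 : ℝ))).sub
      ((hasDerivAt_id x).const_mul (9 / 10 : ℝ))).add_const (3 / 20 : ℝ))
    refine (h.congr_deriv ?_).deriv
    norm_num
    ring
  have hid : ∀ x : ℝ, 3 / 4 * (deriv η₀ x) ^ 2 - η₀ x * deriv (deriv η₀) x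
      = 3 * (14 * x ^ 2 + 6 * x - 3) ^ 2 / 1600 := fun x => by
    rw [hpoly, hderiv2, hderiv]; ring
  have hsq : Real.sqrt 51 ^ 2 = 51 := Real.sq_sqrt (by norm_num)
  have hlo : 3 ≤ Real.sqrt 51 := Real.le_sqrt_of_sq_le (by norm_num)
  have hhi : Real.sqrt 51 < 36 / 5 := (Real.sqrt_lt' (by norm_num)).2 (by norm_num)
  have hx₀_nonneg : 0 ≤ x₀ := by rw [hx₀]; linarith
  have hx₀_lt : x₀ < 3 / 10 := by rw [hx₀]; linarith
  have hroot : 14 * x₀ ^ 2 + 6 * x₀ - 3 = 0 := by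
    rw [hx₀]; linear_combination hsq / 14
  have huniq : ∀ x ∈ Icc (0 : ℝ) 1, 14 * x ^ 2 + 6 * x - 3 = 0 ↔ x = x₀ := by
    intro x hx
    refine ⟨fun h => ?_, fun h => h ▸ hroot⟩
    have hmul : (x - x₀) * (14 * (x + x₀) + 6) = 0 := by linear_combination h - hroot
    have hpos : 14 * (x + x₀) + 6 ≠ 0 := by linarith [hx.1]
    exact sub_eq_zero.1 ((mul_eq_zero.1 hmul).resolve_right hpos)
  refine ⟨hpoly, hid, ⟨⟨hx₀_nonneg, by linarith⟩, huniq⟩, ⟨by rw [hderiv], ?_⟩, fun x hx => ?_⟩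
  · have hred : deriv η₀ x₀ = 663 / 490 - 204 / 49 * x₀ := by
      rw [hderiv]
      linear_combination (-2 / 7 * x₀ + 393 / 980) * hroot
    rw [hred]
    linarith
  · rw [hid]
    refine ⟨by positivity, ?_⟩
    rw [← huniq x hx]
    simp
end

section
/- Let h be a homogeneous cubic polynomial on ℝ^{n+1} and let H ⊆ {x ∈ ℝ^{n+1} : h(x) = 1} be a nonempty smooth hypersurface (not necessarily connected) such that the Hessian D²h_p is negative definite on ker Dh_p for every p ∈ H (a projective special real manifold). Then H is a closed subset of ℝ^{n+1} if and only if for every T ∈ (0, ∞] every smooth curve γ : [0, T) → H that is not contained in any compact subset of H has infinite Euclidean length ∫₀^T |γ'(t)| dt = ∞ (i.e., H is Euclidean complete). -/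
open Set MeasureTheory ENNReal

theorem MvPolynomial.IsHomogeneous.eval_smul {σ R : Type*} [CommSemiring R]
    {P : MvPolynomial σ R} {k : ℕ} (hP : P.IsHomogeneous k) (c : R) (x : σ → R) :
    MvPolynomial.eval (c • x) P = c ^ k * MvPolynomial.eval x P := by
  rw [MvPolynomial.eval_eq, MvPolynomial.eval_eq, Finset.mul_sum]
  refine Finset.sum_congr rfl fun d hd => ?_
  have hdeg : ∑ i ∈ d.support, d i = k := by
    rw [← Finsupp.degree_apply, Finsupp.degree_eq_weight_one]
    exact hP (MvPolynomial.mem_support_iff.1 hd)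
  simp only [Pi.smul_apply, smul_eq_mul, mul_pow, Finset.prod_mul_distrib,
    Finset.prod_pow_eq_pow_sum, hdeg]
  ring

theorem setOf_ofReal_lt_ofReal (s : ℝ) :
    {t : ℝ | 0 ≤ t ∧ ENNReal.ofReal t < ENNReal.ofReal s} = Ico 0 s := by
  ext t
  simp only [mem_ofPred_eq, mem_Ico]
  exact and_congr_right fun ht => ENNReal.ofReal_lt_ofReal_iff_of_nonneg ht

section Curves

variable {E : Type*} [NormedAddCommGroup E] [NormedSpace ℝ E]

/-- The distance travelled by a `C¹` curve is at most its length. -/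
theorem enorm_sub_zero_le_lintegral_derivWithin {γ : ℝ → E} {D : Set ℝ} {t : ℝ} (ht : 0 ≤ t)
    (hD : Icc 0 t ⊆ D) (hγ : ContDiffOn ℝ 1 γ D) :
    ‖γ t - γ 0‖ₑ ≤ ∫⁻ s in D, ENNReal.ofReal ‖derivWithin γ D s‖ := by
  calc ‖γ t - γ 0‖ₑ ≤ ∫⁻ s in Icc 0 t, ‖deriv γ s‖ₑ :=
        enorm_sub_le_lintegral_deriv_of_contDiffOn_Icc (hγ.mono hD) ht
    _ = ∫⁻ s in Icc 0 t, ENNReal.ofReal ‖derivWithin γ D s‖ := by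
        refine lintegral_congr_ae ?_
        rw [← restrict_Ioo_eq_restrict_Icc]
        filter_upwards [self_mem_ae_restrict measurableSet_Ioo] with s hs
        rw [derivWithin_of_mem_nhds (Filter.mem_of_superset (Icc_mem_nhds hs.1 hs.2) hD),
          ofReal_norm]
    _ ≤ _ := lintegral_mono_set hD

/-- A curve of finite length in a closed set is contained in a compact subset. -/
theorem IsClosed.exists_isCompact_of_lintegral_ne_top [ProperSpace E] {H : Set E}
    (hH : IsClosed H) {γ : ℝ → E} {D : Set ℝ} (hD : ∀ t ∈ D, 0 ≤ t ∧ Icc 0 t ⊆ D)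
    (hγ : ContDiffOn ℝ 1 γ D) (hmem : MapsTo γ D H)
    (hlen : ∫⁻ s in D, ENNReal.ofReal ‖derivWithin γ D s‖ ≠ ⊤) :
    ∃ K, IsCompact K ∧ K ⊆ H ∧ γ '' D ⊆ K := by
  set L := ∫⁻ s in D, ENNReal.ofReal ‖derivWithin γ D s‖
  refine ⟨Metric.closedBall (γ 0) L.toReal ∩ H,
    (isCompact_closedBall _ _).inter_right hH, inter_subset_right, ?_⟩
  rintro _ ⟨t, ht, rfl⟩
  refine ⟨?_, hmem ht⟩
  rw [mem_closedBall_iff_norm, ← toReal_enorm]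
  exact ENNReal.toReal_mono hlen
    (enorm_sub_zero_le_lintegral_derivWithin (hD t ht).1 (hD t ht).2 hγ)

/-- A curve that is `C¹` up to its endpoint has finite length. -/
theorem lintegral_derivWithin_Ico_ne_top {γ : ℝ → E} {U : Set ℝ} {s : ℝ} (hU : IsOpen U)
    (hsU : Icc 0 s ⊆ U) (hγ : ContDiffOn ℝ 1 γ U) :
    ∫⁻ t in Ico 0 s, ENNReal.ofReal ‖derivWithin γ (Ico 0 s) t‖ ≠ ⊤ := by
  obtain ⟨C, hC⟩ := isCompact_Icc.exists_bound_of_continuousOn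
    ((hγ.continuousOn_deriv_of_isOpen hU le_rfl).mono hsU)
  refine ne_top_of_le_ne_top (ENNReal.mul_ne_top (b := volume (Ico 0 s))
    (ENNReal.ofReal_ne_top (r := C)) (by simp)) ?_
  rw [← setLIntegral_const]
  refine setLIntegral_mono' measurableSet_Ico fun t ht => ENNReal.ofReal_le_ofReal ?_
  have htU : t ∈ U := hsU (Ico_subset_Icc_self ht)
  rw [((hγ.contDiffAt (hU.mem_nhds htU)).differentiableAt one_ne_zero).derivWithin
    (uniqueDiffOn_Ico 0 s t ht)]
  exact hC t (Ico_subset_Icc_self ht)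

/-- A point in the closure of a relatively open subset `W ∩ {h = 1}` of a level set of a smooth
homogeneous cubic function, but outside of that subset, gives rise to a smooth path in the level
set from the subset to its complement: the radial projection of a segment. -/
theorem exists_contDiffOn_path_levelSet {h : E → ℝ} (hsmooth : ContDiff ℝ (⊤ : ℕ∞) h)
    (hhom : ∀ (c : ℝ) x, h (c • x) = c ^ 3 * h x) {H : Set E} (hHh : H ⊆ {x | h x = 1})
    {q : E} (hq : q ∈ closure H) :
    ∃ (U : Set ℝ) (γ : ℝ → E), IsOpen U ∧ Icc 0 1 ⊆ U ∧ ContDiffOn ℝ (⊤ : ℕ∞) γ U ∧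
      (∀ t ∈ U, h (γ t) = 1) ∧ γ 0 ∈ H ∧ γ 1 = q := by
  have hq1 : h q = 1 :=
    closure_minimal hHh (isClosed_eq hsmooth.continuous continuous_const) hq
  have hnhds : {x | 0 < h x} ∈ nhds q :=
    (isOpen_lt continuous_const hsmooth.continuous).mem_nhds (by simp [hq1])
  obtain ⟨r, hr, hball⟩ := Metric.mem_nhds_iff.1 hnhds
  obtain ⟨p, hpH, hpq⟩ := Metric.mem_closure_iff.1 hq r hr
  have hp1 : h p = 1 := hHh hpH
  have hσ : ContDiff ℝ (⊤ : ℕ∞) fun t : ℝ => AffineMap.lineMap (k := ℝ) p q t := by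
    simp only [AffineMap.lineMap_apply_module']
    fun_prop
  set σ : ℝ → E := fun t => AffineMap.lineMap (k := ℝ) p q t with hσdef
  have hhσ := hsmooth.comp hσ
  refine ⟨{t | 0 < h (σ t)}, fun t => (h (σ t)) ^ (-(3 : ℝ)⁻¹) • σ t,
    isOpen_lt continuous_const hhσ.continuous, ?_, ?_, ?_, ?_, ?_⟩
  · intro t ht
    refine hball ((convex_ball q r).lineMap_mem ?_ (Metric.mem_ball_self hr) ht)
    rwa [Metric.mem_ball, dist_comm]
  · exact (hhσ.contDiffOn.rpow_const_of_ne fun t ht => ne_of_gt ht).smul hσ.contDiffOn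
  · intro t ht
    have ht0 : (0 : ℝ) < h (σ t) := ht
    rw [hhom, Real.rpow_neg ht0.le, inv_pow]
    have := Real.rpow_inv_natCast_pow ht0.le (n := 3) (by norm_num)
    rw [Nat.cast_ofNat] at this
    rw [this, inv_mul_cancel₀ ht0.ne']
  · simpa [hσdef, hp1] using hpH
  · simp [hσdef, hq1]

end Curves

/-- A path that starts in an open set `W` and ends outside of it has a first exit time. -/
theorem exists_first_exit {X : Type*} [TopologicalSpace X] {W : Set X} (hW : IsOpen W)
    {γ : ℝ → X} (hγ : ContinuousOn γ (Icc 0 1)) (h0 : γ 0 ∈ W) (h1 : γ 1 ∉ W) :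
    ∃ s ∈ Icc (0 : ℝ) 1, 0 < s ∧ γ s ∉ W ∧ ∀ t ∈ Ico 0 s, γ t ∈ W := by
  have hclosed : IsClosed (Icc (0 : ℝ) 1 ∩ γ ⁻¹' Wᶜ) :=
    hγ.preimage_isClosed_of_isClosed isClosed_Icc hW.isClosed_compl
  obtain ⟨s, ⟨hs, hsW⟩, hmin⟩ := (isCompact_Icc.of_isClosed_subset hclosed
    inter_subset_left).exists_isLeast ⟨1, by simp, h1⟩
  refine ⟨s, hs, hs.1.lt_of_ne ?_, hsW, fun t ht => ?_⟩
  · rintro rfl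
    exact hsW h0
  · by_contra htW
    exact ht.2.not_ge (hmin ⟨⟨ht.1, ht.2.le.trans hs.2⟩, htW⟩)

/-- A projective special real manifold `H` (a nonempty, not
necessarily connected, smooth hypersurface contained in the level set `{h = 1}` of
a homogeneous cubic polynomial `h`, with `D²h_p` negative definite on `ker Dh_p`
for every `p ∈ H`) is a closed subset of `ℝ^{n+1}` if and only if it is Euclidean
complete, i.e. every smooth curve `γ : [0,T) → H` not contained in any compact
subset of `H` has infinite Euclidean length.

By Euler's identity `Dh_p(p) = 3 ≠ 0` on `{h = 1}`, such a smooth hypersurface is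
the same as an open subset of the level set; we formalize it this way. -/
theorem stmt_19 (n : ℕ)
    (P : MvPolynomial (Fin (n + 1)) ℝ) (hP : P.IsHomogeneous 3)
    (h : EuclideanSpace ℝ (Fin (n + 1)) → ℝ)
    (hh : ∀ x, h x = MvPolynomial.eval (fun i => x i) P)
    (H : Set (EuclideanSpace ℝ (Fin (n + 1))))
    (hne : H.Nonempty)
    (hhyper : ∃ W : Set (EuclideanSpace ℝ (Fin (n + 1))), IsOpen W ∧
      H = W ∩ {x | h x = 1})
    (hhyp : ∀ p ∈ H, ∀ v : EuclideanSpace ℝ (Fin (n + 1)),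
      fderiv ℝ h p v = 0 → v ≠ 0 → fderiv ℝ (fderiv ℝ h) p v v < 0) :
    IsClosed H ↔
      ∀ T : ℝ≥0∞, 0 < T →
        ∀ γ : ℝ → EuclideanSpace ℝ (Fin (n + 1)),
          ContDiffOn ℝ (⊤ : ℕ∞) γ {t : ℝ | 0 ≤ t ∧ ENNReal.ofReal t < T} →
          (∀ t, 0 ≤ t → ENNReal.ofReal t < T → γ t ∈ H) →
          (¬ ∃ K : Set (EuclideanSpace ℝ (Fin (n + 1))), IsCompact K ∧ K ⊆ H ∧
            γ '' {t : ℝ | 0 ≤ t ∧ ENNReal.ofReal t < T} ⊆ K) →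
          ∫⁻ t in {t : ℝ | 0 ≤ t ∧ ENNReal.ofReal t < T},
            ENNReal.ofReal
              ‖derivWithin γ {t : ℝ | 0 ≤ t ∧ ENNReal.ofReal t < T} t‖ = ⊤ := by
  have hsmooth : ContDiff ℝ (⊤ : ℕ∞) h := by
    have := AnalyticOnNhd.eval_continuousLinearMap'
      (fun i : Fin (n + 1) => (EuclideanSpace.proj i : EuclideanSpace ℝ (Fin (n + 1)) →L[ℝ] ℝ)) P
    rw [funext hh]
    exact this.contDiff
  have hhom : ∀ (c : ℝ) x, h (c • x) = c ^ 3 * h x := fun c x => by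
    rw [hh, hh, ← hP.eval_smul]
    rfl
  obtain ⟨W, hW, rfl⟩ := hhyper
  constructor
  · intro hclosed T _ γ hγ hmem hesc
    by_contra hlen
    refine hesc (hclosed.exists_isCompact_of_lintegral_ne_top (fun t ht => ⟨ht.1, ?_⟩)
      (hγ.of_le (by exact_mod_cast le_top)) (fun t ht => hmem t ht.1 ht.2) hlen)
    exact fun u hu => ⟨hu.1, (ENNReal.ofReal_le_ofReal hu.2).trans_lt ht.2⟩
  · intro hcomplete
    refine isClosed_of_closure_subset fun q hq => ?_
    by_contra hqH
    obtain ⟨U, γ, hU, hIU, hγ, hγ1, h0, h1⟩ :=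
      exists_contDiffOn_path_levelSet hsmooth hhom inter_subset_right hq
    have hqW : γ 1 ∉ W := fun hmem =>
      hqH (h1 ▸ ⟨hmem, hγ1 1 (hIU (right_mem_Icc.2 zero_le_one))⟩)
    obtain ⟨s, hs, hs0, hsW, hlt⟩ :=
      exists_first_exit hW (hγ.continuousOn.mono hIU) h0.1 hqW
    have hsU : Icc 0 s ⊆ U := (Icc_subset_Icc_right hs.2).trans hIU
    have key := hcomplete (ENNReal.ofReal s) (ENNReal.ofReal_pos.2 hs0) γ
    simp only [setOf_ofReal_lt_ofReal] at key
    refine lintegral_derivWithin_Ico_ne_top hU hsU (hγ.of_le (by exact_mod_cast le_top))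
      (key (hγ.mono (Ico_subset_Icc_self.trans hsU)) (fun t ht hts => ?_) ?_)
    · have htI : t ∈ Ico 0 s := ⟨ht, (ENNReal.ofReal_lt_ofReal_iff hs0).1 hts⟩
      exact ⟨hlt t htI, hγ1 t (hsU (Ico_subset_Icc_self htI))⟩
    · rintro ⟨K, hK, hKH, hsub⟩
      refine hsW (hKH (hK.isClosed.closure_subset_iff.2 hsub ?_)).1
      have hcont : ContinuousWithinAt γ (Ico 0 s) s :=
        (hγ.continuousOn.continuousAt (hU.mem_nhds (hsU (right_mem_Icc.2 hs0.le)))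
          ).continuousWithinAt
      refine hcont.mem_closure_image ?_
      rw [closure_Ico hs0.ne]
      exact right_mem_Icc.2 hs0.le
end
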